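/- Let G be a finitely generated, conjugacy separable group that is isomorphic to a subgroup of a right-angled Artin group A(Γ) (for some simple graph Γ). Then the outer automorphism group Out(G) is residually finite. -/

import Mathlib

/-- A group `K` is residually finite if every nontrivial element survives in some
finite quotient. -/
def ResiduallyFinite (K : Type*) [Group K] : Prop :=
  ∀ k : K, k ≠ 1 → ∃ (F : Type) (_ : Group F) (_ : Finite F) (f : K →* F), f k ≠ 1

/-- A group `G` is conjugacy separable if non-conjugate elements remain
non-conjugate in some finite quotient. -/
def ConjugacySeparable (G : Type*) [Group G] : Prop :=
  ∀ x y : G, ¬ IsConj x y →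
    ∃ (F : Type) (_ : Group F) (_ : Finite F) (f : G →* F), ¬ IsConj (f x) (f y)

/-- The inner automorphisms form a normal subgroup of `MulAut G`. -/
instance conjRangeNormal (G : Type*) [Group G] :
    ((MulAut.conj : G →* MulAut G).range).Normal := by
  constructor
  intro x hx α
  obtain ⟨g, rfl⟩ := hx
  refine ⟨α g, ?_⟩
  ext h
  simp [MulAut.conj_apply, MulAut.mul_apply]

/-- The outer automorphism group of `G`: the quotient of `MulAut G` by the
inner automorphisms. -/
abbrev OuterAut (G : Type*) [Group G] :=
  MulAut G ⧸ (MulAut.conj : G →* MulAut G).range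

/-- The set of defining relators of the right-angled Artin group on `Γ`. -/
abbrev raagRels {V : Type*} (Γ : SimpleGraph V) : Set (FreeGroup V) :=
  {r | ∃ u v : V, Γ.Adj u v ∧
    r = FreeGroup.of u * FreeGroup.of v * (FreeGroup.of u)⁻¹ * (FreeGroup.of v)⁻¹}

/-- The right-angled Artin group associated to a simple graph `Γ`. -/
abbrev RAAG {V : Type*} (Γ : SimpleGraph V) := PresentedGroup (raagRels Γ)

section

namespace FreeGroup

variable {X : Type*}

theorem isReduced_append_iff {a b : List (X × Bool)} :
    IsReduced (a ++ b) ↔ IsReduced a ∧ IsReduced b ∧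
      ∀ x ∈ a.getLast?, ∀ y ∈ b.head?, x.1 = y.1 → x.2 = y.2 :=
  List.isChain_append

theorem IsReduced.left {a b : List (X × Bool)} (h : IsReduced (a ++ b)) : IsReduced a :=
  (isReduced_append_iff.1 h).1

theorem IsReduced.right {a b : List (X × Bool)} (h : IsReduced (a ++ b)) : IsReduced b :=
  (isReduced_append_iff.1 h).2.1

theorem IsReduced.toWord_mk [DecidableEq X] {a : List (X × Bool)} (h : IsReduced a) :
    (mk a).toWord = a := by
  rw [FreeGroup.toWord_mk, h.reduce_eq]

theorem IsReduced.eq_of_mk_eq {a b : List (X × Bool)} (ha : IsReduced a)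
    (hb : IsReduced b) (h : mk a = mk b) : a = b := by
  classical
  rw [← ha.toWord_mk, ← hb.toWord_mk, h]

theorem IsReduced.invRev {a : List (X × Bool)} (h : IsReduced a) : IsReduced (invRev a) := by
  classical
  have := isReduced_toWord (x := (mk a)⁻¹)
  rwa [toWord_inv, h.toWord_mk] at this

/-- Two reduced words multiply by cancelling a suffix of the first against an initial part of the
second. -/
theorem exists_cancellation {a b : List (X × Bool)} (ha : IsReduced a) (hb : IsReduced b) :
    ∃ α γ β, a = α ++ γ ∧ b = invRev γ ++ β ∧ IsReduced (α ++ β) := by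
  induction a using List.reverseRecOn generalizing b with
  | nil => exact ⟨[], [], b, by simp, by simp, by simpa using hb⟩
  | append_singleton a t ih =>
    by_cases hr : IsReduced ((a ++ [t]) ++ b)
    · exact ⟨a ++ [t], [], b, by simp, by simp, hr⟩
    · rw [isReduced_append_iff] at hr
      push Not at hr
      obtain ⟨x, hx, y, hy, h1, h2⟩ := hr ha hb
      simp only [List.getLast?_append, List.getLast?_singleton, Option.some_or,
        Option.mem_def, Option.some.injEq] at hx
      subst hx
      cases b with
      | nil => simp at hy
      | cons z b =>
        simp only [List.head?_cons, Option.mem_def, Option.some.injEq] at hy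
        subst hy
        obtain ⟨α, γ, β, rfl, rfl, h⟩ := ih ha.left (IsReduced.right (a := [z]) hb)
        refine ⟨α, γ ++ [t], β, by simp, ?_, h⟩
        rw [invRev_append]
        have : FreeGroup.invRev [t] = [z] := by
          obtain ⟨t1, t2⟩ := t
          obtain ⟨z1, z2⟩ := z
          cases t2 <;> cases z2 <;> simp_all [FreeGroup.invRev]
        rw [this]; simp

/-- A reduced word following a cyclically reduced one. -/
theorem IsReduced.cancel_head {f u : List (X × Bool)} {t : X × Bool}
    (hf : IsReduced (f ++ [t])) (hu : IsReduced u) (h : ¬ IsReduced (f ++ [t] ++ u)) :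
    ∃ u', u = (t.1, !t.2) :: u' := by
  rw [isReduced_append_iff] at h
  push Not at h
  obtain ⟨x, hx, y, hy, h1, h2⟩ := h hf hu
  simp only [List.getLast?_append, List.getLast?_singleton, Option.some_or,
    Option.mem_def, Option.some.injEq] at hx
  subst hx
  cases u with
  | nil => simp at hy
  | cons z b =>
    simp only [List.head?_cons, Option.mem_def, Option.some.injEq] at hy
    subst hy
    refine ⟨b, ?_⟩
    obtain ⟨t1, t2⟩ := t
    obtain ⟨z1, z2⟩ := z
    simp at h1 h2 ⊢
    cases t2 <;> cases z2 <;> simp_all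

theorem isReduced_rotate {p q : List (X × Bool)} (h : IsReduced ((p ++ q) ++ (p ++ q))) :
    IsReduced ((q ++ p) ++ (q ++ p)) := by
  rcases eq_or_ne (q ++ p) [] with h0 | h0
  · simp [h0]
  · have h1 : IsReduced (p ++ (q ++ p) ++ q) := by simpa using h
    have h2 : IsReduced (q ++ p) := (IsReduced.left h1).right
    rcases eq_or_ne p [] with rfl | hp
    · simpa using h
    rcases eq_or_ne q [] with rfl | hq
    · simpa using h
    have h3 : IsReduced (q ++ p ++ q) := by
      have : IsReduced (p ++ (q ++ p ++ q)) := by simpa using h1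
      exact this.right
    have := IsReduced.append_overlap h3 h2 hq
    simpa using this

theorem mk_append (a b : List (X × Bool)) : mk (a ++ b) = mk a * mk b := by
  rw [mul_mk]

theorem mk_singleton_inv (t : X × Bool) : mk [(t.1, !t.2)] = (mk [t])⁻¹ := by
  rw [inv_mk]; rfl

/-- Conjugate cyclically reduced words are cyclic rotations of each other, and the conjugator is
determined up to powers. -/
theorem exists_rotation {u v : List (X × Bool)} (f : List (X × Bool)) (hf : IsReduced f)
    (hu : IsReduced (u ++ u)) (hv : IsReduced (v ++ v)) (hu0 : u ≠ [])
    (h : mk f * mk u * (mk f)⁻¹ = mk v) :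
    ∃ (k : ℤ) (p q : List (X × Bool)), v = p ++ q ∧ u = q ++ p ∧ mk f = mk v ^ k * mk p := by
  induction f using List.reverseRecOn generalizing u with
  | nil =>
    have h' : mk u = mk v := by
      have h1 : mk ([] : List (X × Bool)) = 1 := rfl
      simpa [h1] using h
    have : u = v := hu.left.eq_of_mk_eq hv.left h'
    exact ⟨0, [], v, by simp, by simp [this], by simp⟩
  | append_singleton f t ih =>
    have key : mk f * (mk [t] * mk u * (mk [t])⁻¹) * (mk f)⁻¹ = mk v := by
      rw [← h, mk_append]; group
    by_cases h1 : IsReduced (f ++ [t] ++ u)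
    · by_cases h2 : IsReduced (f ++ [t] ++ invRev u)
      · exfalso
        have h3 : IsReduced (u ++ invRev (f ++ [t])) := by
          have := h2.invRev
          rwa [invRev_append, invRev_invRev] at this
        have h4 : IsReduced (f ++ [t] ++ u ++ invRev (f ++ [t])) :=
          IsReduced.append_overlap h1 h3 hu0
        have h5 : f ++ [t] ++ u ++ invRev (f ++ [t]) = v := by
          refine h4.eq_of_mk_eq hv.left ?_
          rw [mk_append, mk_append (f ++ [t]) u, ← h, inv_mk]
        have h6 : IsReduced (invRev (f ++ [t]) ++ (f ++ [t])) := by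
          have h7 : IsReduced ((f ++ [t] ++ u ++ invRev (f ++ [t])) ++
              (f ++ [t] ++ u ++ invRev (f ++ [t]))) := by rwa [h5]
          have h8 : IsReduced ((f ++ [t] ++ u) ++
              ((invRev (f ++ [t]) ++ (f ++ [t])) ++ (u ++ invRev (f ++ [t])))) := by
            simpa only [List.append_assoc] using h7
          exact h8.right.left
        have h7 : invRev (f ++ [t]) ++ (f ++ [t]) = [] := by
          refine h6.eq_of_mk_eq IsReduced.nil ?_
          rw [mk_append, ← inv_mk, inv_mul_cancel]; rfl
        simp at h7
      · obtain ⟨w, hw⟩ := IsReduced.cancel_head hf hu.left.invRev h2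
        have hw' : u = invRev w ++ [t] := by
          rw [← invRev_invRev (L₁ := u), hw]
          simp [FreeGroup.invRev]
        generalize invRev w = u1 at hw'
        subst hw'
        have hu' := isReduced_rotate hu
        obtain ⟨k, p, q, hp, hq, hk⟩ := ih hf.left hu' (by simp) (by
          rw [← key]; simp only [mk_append]; group)
        cases q with
        | nil =>
          simp only [List.append_nil, List.nil_append] at hp hq
          refine ⟨k + 1, [t], u1, ?_, rfl, ?_⟩
          · rw [hp, ← hq]
          · rw [mk_append, hk, hp, zpow_add]; simp [mul_assoc]
        | cons t' q =>
          simp only [List.cons_append, List.cons.injEq, List.nil_append] at hq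
          obtain ⟨rfl, rfl⟩ := hq
          refine ⟨k, p ++ [t], q, by simp [hp], by simp, ?_⟩
          rw [mk_append, hk, mk_append, mul_assoc]
    · obtain ⟨u1, rfl⟩ := IsReduced.cancel_head hf hu.left h1
      have hu' := isReduced_rotate (p := [(t.1, !t.2)]) (q := u1) hu
      obtain ⟨k, p, q, hp, hq, hk⟩ := ih hf.left hu' (by simp) (by
          rw [← key, ← List.singleton_append (l := u1)]
          simp only [mk_append, mk_singleton_inv]; group)
      rcases List.eq_nil_or_concat p with rfl | ⟨p, t', rfl⟩
      · simp only [List.append_nil, List.nil_append] at hp hq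
        refine ⟨k - 1, u1, [(t.1, !t.2)], by rw [hp, hq], rfl, ?_⟩
        rw [mk_append, hk, hp, ← hq, mk_append, mk_singleton_inv, zpow_sub_one]
        have h1 : mk ([] : List (X × Bool)) = 1 := rfl
        rw [h1, mul_one, mul_inv_rev, inv_inv]
        simp only [mul_assoc, inv_mul_cancel, mul_one]
      · rw [List.concat_eq_append, ← List.append_assoc] at hq
        obtain ⟨rfl, h3⟩ := List.append_inj' hq rfl
        rw [List.concat_eq_append] at hp hk
        rw [← h3] at hp hk
        refine ⟨k, p, (t.1, !t.2) :: q, by simp [hp], by simp, ?_⟩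
        rw [mk_append, hk, mk_append, mk_singleton_inv]; group

end FreeGroup

end

section

theorem eq_one_of_conj_eq_inv {G : Type*} [Group G] [IsMulTorsionFree G] {z s : G}
    (h : z * s * z⁻¹ = s⁻¹) : s = 1 := by
  have h1 : (z * s) ^ 2 = z ^ 2 := by
    have : z * s = s⁻¹ * z := by rw [← h]; group
    calc (z * s) ^ 2 = (z * s) * (z * s) := pow_two _
      _ = z * s * (s⁻¹ * z) := by rw [← this]
      _ = z ^ 2 := by rw [pow_two]; group
  simpa using pow_left_injective two_ne_zero h1

namespace FreeGroup

variable {X : Type*}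

theorem mk_flatten_replicate (s : List (X × Bool)) (n : ℕ) :
    mk (List.replicate n s).flatten = mk s ^ n := by
  rw [pow_mk]

theorem length_flatten_replicate (s : List (X × Bool)) (n : ℕ) :
    (List.replicate n s).flatten.length = n * s.length := by
  simp

theorem invRev_flatten_replicate (s : List (X × Bool)) (n : ℕ) :
    invRev (List.replicate n s).flatten = (List.replicate n (invRev s)).flatten := by
  induction n with
  | zero => simp
  | succ n ih =>
    rw [List.replicate_succ', List.replicate_succ]
    simp [invRev_append, ih]

theorem isReduced_flatten_replicate {s : List (X × Bool)} (h : IsReduced (s ++ s)) (n : ℕ) :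
    IsReduced (List.replicate n s).flatten := by
  rcases n.eq_zero_or_pos with rfl | hn
  · simp
  · have := IsReduced.append_flatten_replicate_append (L₁ := []) (L₂ := s) (L₃ := []) (n := n)
      (isReduced_append_iff.1 h |>.2) (by simpa using h.left) hn.ne'
    simpa using this

theorem isCyclicallyReduced_iff_append_self {s : List (X × Bool)} :
    IsCyclicallyReduced s ↔ IsReduced (s ++ s) := by
  rw [isReduced_append_iff, isCyclicallyReduced_iff]; tauto

theorem append_append_suffix_replicate (s : List (X × Bool)) (n : ℕ) :
    s ++ s <:+ (List.replicate (n + 2) s).flatten := by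
  refine ⟨(List.replicate n s).flatten, ?_⟩
  rw [List.replicate_add]; simp [List.replicate_succ]

/-- Conjugation-like sandwiching by large powers of a cyclically reduced word produces words
beginning and ending with that word. -/
theorem exists_sandwich {s : List (X × Bool)} (hs : IsReduced (s ++ s)) (hs0 : s ≠ [])
    (x : FreeGroup X) : ∃ P : ℕ, ∀ p ≥ P, ∃ w, IsReduced (s ++ w ++ s) ∧
      mk s ^ p * x * mk s ^ p = mk (s ++ w ++ s) := by
  classical
  have hL : 1 ≤ s.length := List.length_pos_iff.2 hs0
  obtain ⟨a, ha, rfl⟩ : ∃ a, IsReduced a ∧ mk a = x := ⟨x.toWord, isReduced_toWord, mk_toWord⟩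
  obtain ⟨z, hz, hzs⟩ : ∃ z, IsReduced (z ++ s ++ s) ∧
      mk a * mk s ^ (a.length + 2) = mk (z ++ s ++ s) := by
    obtain ⟨α, γ, β, h1, h2, h3⟩ := exists_cancellation ha
      (isReduced_flatten_replicate hs (a.length + 2))
    have hlen := congrArg List.length h2
    simp only [length_flatten_replicate, List.length_append, invRev_length] at hlen
    have hla := congrArg List.length h1
    simp only [List.length_append] at hla
    have h4 : s ++ s <:+ β := by
      refine List.suffix_of_suffix_length_le (append_append_suffix_replicate s a.length)
        (h2 ▸ List.suffix_append _ _) ?_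
      rw [List.length_append]; nlinarith
    obtain ⟨β', rfl⟩ := h4
    refine ⟨α ++ β', by simpa using h3, ?_⟩
    rw [← mk_flatten_replicate, h2, h1]
    simp only [mk_append, ← inv_mk]
    group
  set K := a.length + 2 with hK
  refine ⟨K + 1 + (z ++ s).length, fun p hp => ?_⟩
  obtain ⟨j, rfl⟩ : ∃ j, p = K + j := ⟨p - K, by omega⟩
  have hb : IsReduced (z ++ s ++ (List.replicate j s).flatten ++ s) := by
    have := IsReduced.append_flatten_replicate_append (L₁ := z) (L₂ := s) (L₃ := []) (n := j + 2)
      (isReduced_append_iff.1 hs |>.2) (by simpa using hz.left) (by omega)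
    rw [show j + 2 = 1 + j + 1 by omega, List.replicate_add, List.replicate_add] at this
    simpa using this
  obtain ⟨α, γ, β, h1, h2, h3⟩ := exists_cancellation
    (isReduced_flatten_replicate hs (K + j)) hb
  have hl1 := congrArg List.length h1
  have hl2 := congrArg List.length h2
  simp only [length_flatten_replicate, List.length_append, invRev_length] at hl1 hl2 hp
  have hγ : γ.length < (z ++ s).length := by
    by_contra! hge
    have h4 : z ++ s <+: invRev γ := by
      refine List.prefix_of_prefix_length_le (l₃ := invRev γ ++ β) ?_ (List.prefix_append _ _)
        (by simpa using hge)
      rw [← h2, List.append_assoc _ _ s]; exact List.prefix_append _ _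
    have h5 : z ++ s <+: (List.replicate (K + j) (invRev s)).flatten := by
      rw [← invRev_flatten_replicate, h1, invRev_append]
      exact h4.trans (List.prefix_append _ _)
    have h6 : invRev s ++ z <+: (List.replicate (K + j + 1) (invRev s)).flatten := by
      rw [List.replicate_succ, List.flatten_cons, List.prefix_append_right_inj]
      exact (List.prefix_append _ _).trans h5
    have h7 : z ++ s <+: (List.replicate (K + j + 1) (invRev s)).flatten := by
      refine h5.trans ?_
      rw [List.replicate_succ', List.flatten_append]
      exact List.prefix_append _ _
    have h8 : z ++ s = invRev s ++ z :=
      (List.prefix_of_prefix_length_le h7 h6 (by simp [add_comm])).eq_of_length (by simp [add_comm])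
    have h9 := congrArg mk h8
    rw [mk_append, mk_append, ← inv_mk] at h9
    have h10 := eq_one_of_conj_eq_inv (z := mk z) (s := mk s) (by rw [h9]; group)
    exact hs0 (hs.left.eq_of_mk_eq IsReduced.nil h10)
  rw [List.length_append] at hγ
  have hs1 : s <+: α := by
    refine List.prefix_of_prefix_length_le (l₃ := α ++ γ) ?_ (List.prefix_append _ _)
      (by nlinarith)
    rw [← h1, show K + j = (K + j - 1) + 1 by omega, List.replicate_succ]
    exact List.prefix_append _ _
  have hs2 : s <:+ β := by
    refine List.suffix_of_suffix_length_le (l₃ := invRev γ ++ β) ?_ (List.suffix_append _ _)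
      (by nlinarith)
    rw [← h2]; exact List.suffix_append _ _
  obtain ⟨α', rfl⟩ := hs1
  obtain ⟨β', rfl⟩ := hs2
  refine ⟨α' ++ β', by simpa using h3, ?_⟩
  have h4 : mk a * mk s ^ (K + j) = mk (z ++ s ++ (List.replicate j s).flatten ++ s) := by
    rw [pow_add, ← mul_assoc, hzs]
    simp only [mk_append, mk_flatten_replicate, mul_assoc]
    rw [(Commute.refl (mk s)).pow_right j |>.eq]
  rw [mul_assoc, h4, h2, ← mk_flatten_replicate, h1]
  simp only [mk_append, ← inv_mk]
  group

end FreeGroup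

end

section

namespace FreeGroup

variable {X : Type*}

open Classical in
/-- The length of the reduced word representing an element of a free group. -/
noncomputable def wordLength (w : FreeGroup X) : ℕ := w.norm

open Classical in
/-- The generators occurring in the reduced word representing an element of a free group. -/
def letters (w : FreeGroup X) : Set X := {i | ∃ b, (i, b) ∈ w.toWord}

theorem exists_isReduced_mk (w : FreeGroup X) : ∃ a, IsReduced a ∧ mk a = w := by
  classical
  exact ⟨w.toWord, isReduced_toWord, mk_toWord⟩

theorem wordLength_mk {a : List (X × Bool)} (h : IsReduced a) : wordLength (mk a) = a.length := by
  classical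
  rw [wordLength, norm, h.toWord_mk]

theorem wordLength_mk_le (a : List (X × Bool)) : wordLength (mk a) ≤ a.length := by
  classical exact norm_mk_le

theorem wordLength_mul_le (x y : FreeGroup X) :
    wordLength (x * y) ≤ wordLength x + wordLength y := by
  classical exact norm_mul_le x y

@[simp]
theorem wordLength_inv (x : FreeGroup X) : wordLength x⁻¹ = wordLength x := by
  classical exact norm_inv_eq

@[simp]
theorem wordLength_one : wordLength (1 : FreeGroup X) = 0 := by
  classical exact norm_one

theorem mem_letters_mk {a : List (X × Bool)} (h : IsReduced a) {i : X} :
    i ∈ letters (mk a) ↔ ∃ b, (i, b) ∈ a := by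
  classical
  rw [letters, h.toWord_mk]; rfl

theorem letters_finite (w : FreeGroup X) : (letters w).Finite := by
  classical
  refine ((w.toWord.toFinset.image Prod.fst).finite_toSet).subset ?_
  rintro i ⟨b, hb⟩
  simp only [Finset.coe_image, Set.mem_image, Finset.mem_coe, List.mem_toFinset]
  exact ⟨(i, b), hb, rfl⟩

theorem letters_mul (x y : FreeGroup X) : letters (x * y) ⊆ letters x ∪ letters y := by
  classical
  rintro i ⟨b, hb⟩
  have := (toWord_mul_sublist x y).subset (by convert hb)
  rcases List.mem_append.1 this with h | h
  · exact Or.inl ⟨b, by convert h⟩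
  · exact Or.inr ⟨b, by convert h⟩

theorem letters_one : letters (1 : FreeGroup X) = ∅ := by
  ext i; simp [letters]

theorem letters_inv (x : FreeGroup X) : letters x⁻¹ = letters x := by
  obtain ⟨a, ha, rfl⟩ := exists_isReduced_mk x
  ext i
  rw [inv_mk, mem_letters_mk ha.invRev, mem_letters_mk ha]
  simp [invRev, or_comm]

theorem letters_pow (x : FreeGroup X) (k : ℕ) : letters (x ^ k) ⊆ letters x := by
  induction k with
  | zero => simp [letters_one]
  | succ k ih =>
    rw [pow_succ]
    exact (letters_mul _ _).trans (Set.union_subset ih subset_rfl)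

theorem letters_zpow (x : FreeGroup X) (k : ℤ) : letters (x ^ k) ⊆ letters x := by
  obtain ⟨n, rfl | rfl⟩ := k.eq_nat_or_neg
  · simpa using letters_pow x n
  · simpa [letters_inv] using letters_pow x n

/-- Every nontrivial element is conjugate to a nonempty cyclically reduced word. -/
theorem exists_conj_cyclicallyReduced {n : FreeGroup X} (hn : n ≠ 1) :
    ∃ (c : FreeGroup X) (s : List (X × Bool)), IsReduced (s ++ s) ∧ s ≠ [] ∧
      n = c * mk s * c⁻¹ := by
  classical
  have h := reduceCyclically.conj_conjugator_reduceCyclically n.toWord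
  have hr := isCyclicallyReduced_iff_append_self.1
    (reduceCyclically.isCyclicallyReduced (isReduced_toWord (x := n)))
  have h1 : n = mk (reduceCyclically.conjugator n.toWord) * mk (reduceCyclically n.toWord) *
      (mk (reduceCyclically.conjugator n.toWord))⁻¹ := by
    rw [inv_mk, mul_mk, mul_mk, h, mk_toWord]
  refine ⟨_, _, hr, ?_, h1⟩
  intro h0
  rw [h0] at h1
  apply hn
  have h2 : mk ([] : List (X × Bool)) = 1 := rfl
  rw [h1, h2, mul_one, mul_inv_cancel]

theorem wordLength_mk_pow {s : List (X × Bool)} (hs : IsReduced (s ++ s)) (k : ℕ) :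
    wordLength (mk s ^ k) = k * s.length := by
  rw [← mk_flatten_replicate, wordLength_mk (isReduced_flatten_replicate hs k),
    length_flatten_replicate]

theorem wordLength_mk_zpow {s : List (X × Bool)} (hs : IsReduced (s ++ s)) (k : ℤ) :
    wordLength (mk s ^ k) = k.natAbs * s.length := by
  obtain ⟨n, rfl | rfl⟩ := k.eq_nat_or_neg
  · rw [zpow_natCast, wordLength_mk_pow hs, Int.natAbs_natCast]
  · rw [zpow_neg, wordLength_inv, zpow_natCast, wordLength_mk_pow hs, Int.natAbs_neg,
      Int.natAbs_natCast]

/-- The lengths of the powers of an element grow linearly. -/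
theorem exists_wordLength_zpow (n : FreeGroup X) : ∃ l c : ℕ, (n ≠ 1 → 0 < l) ∧ ∀ k : ℤ,
    k.natAbs * l ≤ wordLength (n ^ k) + c ∧ wordLength (n ^ k) ≤ k.natAbs * l + c := by
  rcases eq_or_ne n 1 with rfl | hn
  · exact ⟨0, 0, by simp, by simp⟩
  obtain ⟨c, s, hs, hs0, rfl⟩ := exists_conj_cyclicallyReduced hn
  refine ⟨s.length, 2 * wordLength c, fun _ => List.length_pos_iff.2 hs0, fun k => ?_⟩
  rw [← wordLength_mk_zpow hs, conj_zpow]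
  constructor
  · have h1 := wordLength_mul_le (c⁻¹ * (c * mk s ^ k * c⁻¹)) c
    have h2 := wordLength_mul_le (c⁻¹) (c * mk s ^ k * c⁻¹)
    have h3 : c⁻¹ * (c * mk s ^ k * c⁻¹) * c = mk s ^ k := by group
    rw [h3] at h1
    simp only [wordLength_inv] at h1 h2
    omega
  · have h1 := wordLength_mul_le (c * mk s ^ k) c⁻¹
    have h2 := wordLength_mul_le c (mk s ^ k)
    simp only [wordLength_inv] at h1 h2
    omega

/-- The automorphisms of a free group induced by a permutation action on the basis. -/
def permAut (P X : Type*) [Group P] [MulAction P X] : P →* MulAut (FreeGroup X) where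
  toFun p := freeGroupCongr (MulAction.toPerm p)
  map_one' := by
    apply MulEquiv.toMonoidHom_injective
    ext x
    simp [freeGroupCongr]
  map_mul' p q := by
    apply MulEquiv.toMonoidHom_injective
    ext x
    simp [freeGroupCongr, mul_smul]

section permAut

variable {P : Type*} [Group P] [MulAction P X]

@[simp]
theorem permAut_of (p : P) (x : X) : permAut P X p (of x) = of (p • x) := by
  simp [permAut]

theorem permAut_mk (p : P) (a : List (X × Bool)) :
    permAut P X p (mk a) = mk (a.map fun x => (p • x.1, x.2)) := rfl

theorem IsReduced.smul (p : P) {a : List (X × Bool)} (h : IsReduced a) :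
    IsReduced (a.map fun x => (p • x.1, x.2)) := by
  refine List.isChain_map_of_isChain _ ?_ h
  intro x y hxy
  simpa using hxy

@[simp]
theorem wordLength_permAut (p : P) (w : FreeGroup X) :
    wordLength (permAut P X p w) = wordLength w := by
  obtain ⟨a, ha, rfl⟩ := exists_isReduced_mk w
  rw [permAut_mk, wordLength_mk (ha.smul p), wordLength_mk ha, List.length_map]

theorem permAut_eq_self_iff {p : P} {w : FreeGroup X} :
    permAut P X p w = w ↔ ∀ i ∈ letters w, p • i = i := by
  obtain ⟨a, ha, rfl⟩ := exists_isReduced_mk w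
  simp only [mem_letters_mk ha]
  rw [permAut_mk]
  constructor
  · intro h
    have h' := (ha.smul p).eq_of_mk_eq ha h
    nth_rewrite 2 [← List.map_id a] at h'
    rw [List.map_inj_left] at h'
    rintro i ⟨b, hb⟩
    simpa using congrArg Prod.fst (h' _ hb)
  · intro h
    congr 1
    nth_rewrite 2 [← List.map_id a]
    rw [List.map_inj_left]
    intro x hx
    ext <;> simp
    exact h x.1 ⟨x.2, hx⟩

theorem letters_permAut (p : P) (w : FreeGroup X) {i : X} (hi : i ∈ letters w) :
    p • i ∈ letters (permAut P X p w) := by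
  obtain ⟨a, ha, rfl⟩ := exists_isReduced_mk w
  rw [permAut_mk, mem_letters_mk (ha.smul p)]
  obtain ⟨b, hb⟩ := (mem_letters_mk ha).1 hi
  exact ⟨b, List.mem_map.2 ⟨_, hb, rfl⟩⟩

end permAut

end FreeGroup

end

section

open FreeGroup hiding map_one map_mul map_inv map
open SemidirectProduct hiding map

/-- The semidirect product of a free group by a group permuting its basis. -/
abbrev PermProd (P X : Type*) [Group P] [MulAction P X] := FreeGroup X ⋊[permAut P X] P

namespace PermProd

variable {P X : Type*} [Group P] [MulAction P X]

/-- The displacement of the identity vertex in the Cayley tree of the free factor. -/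
noncomputable def len (h : PermProd P X) : ℕ := wordLength h.left

theorem len_mul_le (g h : PermProd P X) : len (g * h) ≤ len g + len h := by
  simpa [len] using wordLength_mul_le g.left (permAut P X g.right h.left)

@[simp]
theorem len_inv (g : PermProd P X) : len g⁻¹ = len g := by
  simp only [len, inv_left, wordLength_permAut, wordLength_inv]

@[simp]
theorem len_inl (n : FreeGroup X) : len (inl n : PermProd P X) = wordLength n := rfl

@[simp]
theorem len_inr (p : P) : len (inr p : PermProd P X) = 0 := by simp [len]

theorem eq_inr_of_left_eq_one {h : PermProd P X} (hh : h.left = 1) : h = inr h.right := by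
  ext <;> simp [hh]

theorem conj_inl (h : PermProd P X) (n : FreeGroup X) :
    h * inl n * h⁻¹ = inl (h.left * permAut P X h.right n * h.left⁻¹) := by
  ext <;> simp

/-- An element is bounded when its powers have bounded displacement. -/
def Bdd (h : PermProd P X) : Prop := ∃ B : ℕ, ∀ k : ℤ, len (h ^ k) ≤ B

/-- `FixAt q h` says that `h` fixes the vertex `q` of the Cayley tree. -/
def FixAt (q : FreeGroup X) (h : PermProd P X) : Prop := ((inl q)⁻¹ * h * inl q).left = 1

theorem Bdd.conj {h : PermProd P X} (hh : Bdd h) (g : PermProd P X) : Bdd (g * h * g⁻¹) := by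
  obtain ⟨B, hB⟩ := hh
  refine ⟨len g + B + len g, fun k => ?_⟩
  rw [conj_zpow]
  have h1 := len_mul_le (g * h ^ k) g⁻¹
  have h2 := len_mul_le g (h ^ k)
  have h3 := hB k
  rw [len_inv] at h1
  omega

theorem bdd_conj_iff {h : PermProd P X} (g : PermProd P X) : Bdd (g * h * g⁻¹) ↔ Bdd h := by
  refine ⟨fun hh => ?_, fun hh => hh.conj g⟩
  have := hh.conj g⁻¹
  have h2 : g⁻¹ * (g * h * g⁻¹) * g⁻¹⁻¹ = h := by group
  rwa [h2] at this

theorem bdd_inv_conj_iff {h : PermProd P X} (g : PermProd P X) : Bdd (g⁻¹ * h * g) ↔ Bdd h := by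
  simpa using bdd_conj_iff (h := h) g⁻¹

theorem Bdd.zpow {h : PermProd P X} (hh : Bdd h) (m : ℤ) : Bdd (h ^ m) := by
  obtain ⟨B, hB⟩ := hh
  exact ⟨B, fun k => by rw [← zpow_mul]; exact hB _⟩

theorem Bdd.inv {h : PermProd P X} (hh : Bdd h) : Bdd h⁻¹ := by
  simpa using hh.zpow (-1)

theorem Bdd.pow {h : PermProd P X} (hh : Bdd h) (m : ℕ) : Bdd (h ^ m) := by
  simpa using hh.zpow m

theorem Bdd.mul {g h : PermProd P X} (hg : Bdd g) (hh : Bdd h) (hc : Commute g h) :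
    Bdd (g * h) := by
  obtain ⟨B, hB⟩ := hg
  obtain ⟨C, hC⟩ := hh
  refine ⟨B + C, fun k => ?_⟩
  rw [hc.mul_zpow]
  exact (len_mul_le _ _).trans (add_le_add (hB k) (hC k))

theorem Bdd.of_pow {h : PermProd P X} {m : ℕ} (hm : m ≠ 0) (hh : Bdd (h ^ m)) : Bdd h := by
  obtain ⟨B, hB⟩ := hh
  refine ⟨B + ∑ r ∈ Finset.range m, len (h ^ r), fun k => ?_⟩
  have hm' : (0 : ℤ) < m := by positivity
  obtain ⟨r, hr⟩ := Int.eq_ofNat_of_zero_le (Int.emod_nonneg k hm'.ne')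
  have hr2 := Int.emod_lt_of_pos k hm'
  have hk : h ^ k = (h ^ m) ^ (k / m) * h ^ r := by
    rw [← zpow_natCast h m, ← zpow_mul, ← zpow_natCast h r, ← zpow_add]
    congr 1
    have := Int.mul_ediv_add_emod k m
    rw [hr] at this
    exact this.symm
  rw [hk]
  refine (len_mul_le _ _).trans (add_le_add (hB _) ?_)
  exact Finset.single_le_sum (f := fun r => len (h ^ r)) (fun _ _ => Nat.zero_le _)
    (Finset.mem_range.2 (by omega))

theorem eq_one_of_bdd_inl {n : FreeGroup X} (h : Bdd (inl n : PermProd P X)) : n = 1 := by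
  by_contra hn
  obtain ⟨B, hB⟩ := h
  obtain ⟨l, c, hl, hk⟩ := exists_wordLength_zpow n
  have h1 := (hk (B + c + 1 : ℕ)).1
  have h2 := hB (B + c + 1 : ℕ)
  rw [← map_zpow, len_inl] at h2
  have h3 := hl hn
  simp only [Int.natAbs_natCast] at h1
  nlinarith

theorem bdd_of_left_eq_one {h : PermProd P X} (hh : h.left = 1) : Bdd h := by
  refine ⟨0, fun k => ?_⟩
  rw [eq_inr_of_left_eq_one hh, ← map_zpow, len_inr]

theorem FixAt.bdd {q : FreeGroup X} {h : PermProd P X} (hh : FixAt q h) : Bdd h := by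
  rw [← bdd_inv_conj_iff (inl q)]
  exact bdd_of_left_eq_one hh

theorem left_pow_isReduced {a : List (X × Bool)} {b : P}
    (h : IsReduced (a ++ a.map fun x => (b • x.1, x.2))) (ha : a ≠ []) (k : ℕ) :
    ∃ w, IsReduced (a ++ w) ∧ w.length = k * a.length ∧
      ((⟨mk a, b⟩ : PermProd P X) ^ (k + 1)).left = mk (a ++ w) := by
  induction k with
  | zero => exact ⟨[], by simpa using h.left, by simp, by simp⟩
  | succ k ih =>
    obtain ⟨w, hw, hl, hk⟩ := ih
    refine ⟨(a ++ w).map fun x => (b • x.1, x.2), ?_, ?_, ?_⟩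
    · rw [List.map_append, ← List.append_assoc]
      refine IsReduced.append_overlap h ?_ (by simpa using ha)
      simpa using hw.smul b
    · simp [hl]; ring
    · rw [pow_succ', mul_left, hk, permAut_mk, mk_append]

/-- A bounded element fixes a vertex. -/
theorem Bdd.exists_fixAt {h : PermProd P X} (hh : Bdd h) : ∃ q, FixAt q h := by
  induction hN : len h using Nat.strong_induction_on generalizing h with
  | _ N ih =>
  obtain ⟨a, ha, hah⟩ := exists_isReduced_mk h.left
  have hh' : h = ⟨mk a, h.right⟩ := by ext <;> simp [hah]
  generalize h.right = b at hh'
  subst hh'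
  rcases eq_or_ne a [] with rfl | ha0
  · exact ⟨1, by simp [FixAt]; rfl⟩
  have hNa : N = a.length := by rw [← hN, len, wordLength_mk ha]
  by_cases hr : IsReduced (a ++ a.map fun x => (b • x.1, x.2))
  · exfalso
    obtain ⟨B, hB⟩ := hh
    obtain ⟨w, hw, hl, hk⟩ := left_pow_isReduced hr ha0 B
    have h1 := hB (B + 1 : ℕ)
    rw [zpow_natCast, len, hk, wordLength_mk hw, List.length_append, hl] at h1
    have h2 := List.length_pos_iff.2 ha0
    nlinarith
  · rcases List.eq_nil_or_concat a with rfl | ⟨a', t, rfl⟩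
    · exact absurd rfl ha0
    rw [List.concat_eq_append] at *
    obtain ⟨u, hu⟩ := IsReduced.cancel_head ha (ha.smul b) hr
    cases a' with
    | nil => simp at hu
    | cons r a' =>
      simp only [List.cons_append, List.map_cons, List.cons.injEq, Prod.mk.injEq] at hu
      have key : (inl (mk [r]))⁻¹ * (⟨mk (r :: a' ++ [t]), b⟩ : PermProd P X) * inl (mk [r]) =
          ⟨mk a', b⟩ := by
        ext
        · have h1 : permAut P X b (mk [r]) = (mk [t])⁻¹ := by
            rw [permAut_mk, ← mk_singleton_inv]; simp [hu.1]
          have h2 : mk (r :: a' ++ [t]) = mk [r] * mk a' * mk [t] := by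
            rw [mk_append, ← List.singleton_append, mk_append]
          have h3 : (inl (mk [r]))⁻¹ = (inl (mk [r])⁻¹ : PermProd P X) :=
            (MonoidHom.map_inv _ _).symm
          rw [h3]
          simp only [mul_left, left_inl, right_inl, map_one, MulAut.one_apply,
            mul_right, one_mul]
          rw [h1, h2]
          group
        · simp
      obtain ⟨q, hq⟩ := ih (len (⟨mk a', b⟩ : PermProd P X)) (by
        have : len (⟨mk a', b⟩ : PermProd P X) ≤ a'.length := wordLength_mk_le a'
        simp at hNa
        omega) (h := ⟨mk a', b⟩) (by rw [← key, bdd_inv_conj_iff]; exact hh) rfl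
      refine ⟨mk [r] * q, ?_⟩
      rw [FixAt] at hq ⊢
      rw [← hq, ← key, map_mul]
      congr 1; group

end PermProd

end

section

open FreeGroup hiding map_one map_mul map_inv map
open SemidirectProduct hiding map

namespace FreeGroup

variable {X : Type*}

theorem append_eq_append_of_flatten {S T p q : List (X × Bool)} {n : ℕ}
    (hl : S.length = T.length) (hT : T <+: q)
    (hS : (List.replicate (n + 1) S).flatten <+: p ++ q) (hp : p.length ≤ n * S.length) :
    p ++ T = S ++ p := by
  have h1 : p ++ T <+: (List.replicate (n + 1) S).flatten := by
    refine List.prefix_of_prefix_length_le ((List.prefix_append_right_inj p).2 hT) hS ?_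
    rw [length_flatten_replicate, List.length_append]; nlinarith
  have h2 : p <+: (List.replicate n S).flatten := by
    refine List.prefix_of_prefix_length_le ((List.prefix_append p T).trans h1) ?_
      (by rwa [length_flatten_replicate])
    rw [List.replicate_succ', List.flatten_append]
    exact List.prefix_append _ _
  have h3 : S ++ p <+: (List.replicate (n + 1) S).flatten := by
    rw [List.replicate_succ, List.flatten_cons, List.prefix_append_right_inj]
    exact h2
  exact (List.prefix_of_prefix_length_le h1 h3 (by simp; omega)).eq_of_length (by simp; omega)

theorem isReduced_replicate_sandwich {S w : List (X × Bool)} (hS : IsReduced (S ++ S))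
    (hw : IsReduced (S ++ w ++ S)) (hS0 : S ≠ []) {n : ℕ} (hn : n ≠ 0) :
    IsReduced (((List.replicate n S).flatten ++ (w ++ S)) ++
      ((List.replicate n S).flatten ++ (w ++ S))) := by
  have h1 := IsReduced.append_flatten_replicate_append (L₁ := []) (L₂ := S) (L₃ := w ++ S)
    (isCyclicallyReduced_iff_append_self.2 hS) (by simpa using hw) hn
  have h2 : IsReduced (S ++ S ++ (w ++ S)) :=
    IsReduced.append_overlap hS (by simpa using hw) hS0
  have h3 := IsReduced.append_flatten_replicate_append (L₁ := S) (L₂ := S) (L₃ := w ++ S)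
    (isCyclicallyReduced_iff_append_self.2 hS) h2 hn
  have h4 : IsReduced (((List.replicate n S).flatten ++ w) ++ S ++
      ((List.replicate n S).flatten ++ (w ++ S))) :=
    IsReduced.append_overlap (by simpa using h1) (by simpa using h3) hS0
  simpa using h4

end FreeGroup

namespace PermProd

variable {P X : Type*} [Group P] [MulAction P X]

theorem commute_inl_of_conj_eq {x : PermProd P X} {s : FreeGroup X}
    (h : x.left * permAut P X x.right s * x.left⁻¹ = s) : Commute x (inl s) := by
  have h1 : x * inl s * x⁻¹ = inl s := by rw [conj_inl, h]
  rw [commute_iff_eq]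
  nth_rewrite 2 [← h1]
  group

theorem conj_eq_of_commute_inl {x : PermProd P X} {s : FreeGroup X}
    (h : Commute x (inl s)) : x.left * permAut P X x.right s * x.left⁻¹ = s := by
  apply inl_injective (φ := permAut P X)
  rw [← conj_inl, h.eq]; group

theorem inl_zpow_mul_left (v : FreeGroup X) (k : ℤ) (h : PermProd P X) :
    ((inl v) ^ k * h).left = v ^ k * h.left ∧ ((inl v) ^ k * h).right = h.right := by
  have h1 : (inl v : PermProd P X) ^ k = inl (v ^ k) := (map_zpow _ _ _).symm
  rw [h1, mul_left, mul_right, left_inl, right_inl, map_one, MulAut.one_apply, one_mul]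
  exact ⟨rfl, rfl⟩

/-- If an element conjugates one long power-like word to another one, then up to a power of the
target it commutes with the base of the power. -/
theorem exists_commute_of_conj_word {S w w' : List (X × Bool)} (hS : IsReduced (S ++ S))
    (hS0 : S ≠ []) (hw : IsReduced (S ++ w ++ S)) (hw' : IsReduced (S ++ w' ++ S)) {n : ℕ}
    (hn : w.length + 4 ≤ n) {h : PermProd P X}
    (hh : h * inl (mk S ^ n * mk (w ++ S)) * h⁻¹ = inl (mk S ^ n * mk (w' ++ S))) :
    ∃ k : ℤ, Commute (inl (mk S ^ n * mk (w' ++ S)) ^ k * h) (inl (mk S)) := by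
  have hL := List.length_pos_iff.2 hS0
  have hu := isReduced_replicate_sandwich hS hw hS0 (n := n) (by omega)
  have hv := isReduced_replicate_sandwich hS hw' hS0 (n := n) (by omega)
  have hur := hu.smul h.right
  rw [conj_inl, inl_inj] at hh
  obtain ⟨f, hf, hfl⟩ := exists_isReduced_mk h.left
  rw [← mk_flatten_replicate, ← mk_append, ← mk_append, ← hfl, permAut_mk] at hh
  rw [List.map_append] at hur
  obtain ⟨k, p, q, hp, hq, hk⟩ := exists_rotation f hf hur hv (by simp [hS0]) hh
  rw [← mk_flatten_replicate, ← mk_append]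
  have hwl : w.length = w'.length := by
    have h1 := congrArg List.length hp
    have h2 := congrArg List.length hq
    simp at h1 h2
    omega
  have hlen := congrArg List.length hp
  rw [List.length_append, List.length_append, List.length_append, length_flatten_replicate,
    ← hwl] at hlen
  set T := S.map fun x => (h.right • x.1, x.2) with hT
  have hTl : S.length = T.length := by simp [hT]
  obtain ⟨m, rfl⟩ : ∃ m, n = m + 1 := ⟨n - 1, by omega⟩
  have hqT : (List.replicate (m + 1) T).flatten <+: q ++ p := by
    rw [← hq, List.map_append, List.map_flatten, List.map_replicate]
    exact List.prefix_append _ _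
  have hpS : (List.replicate (m + 1) S).flatten <+: p ++ q := by
    rw [← hp]; exact List.prefix_append _ _
  rcases le_or_gt p.length (m * S.length) with hc | hc
  · have h1 : T <+: q := by
      refine List.prefix_of_prefix_length_le (l₃ := q ++ p) (List.IsPrefix.trans ?_ hqT)
        (List.prefix_append _ _) (by nlinarith)
      rw [List.replicate_succ]; exact List.prefix_append _ _
    have h2 := congrArg mk (append_eq_append_of_flatten hTl h1 hpS hc)
    rw [mk_append, mk_append] at h2
    refine ⟨-k, commute_inl_of_conj_eq ?_⟩
    rw [(inl_zpow_mul_left _ _ _).1, (inl_zpow_mul_left _ _ _).2, ← hfl, hk, permAut_mk, ← hT,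
      zpow_neg, inv_mul_cancel_left, h2]
    group
  · have h1 : S <+: p := by
      refine List.prefix_of_prefix_length_le (l₃ := p ++ q) (List.IsPrefix.trans ?_ hpS)
        (List.prefix_append _ _) (by nlinarith)
      rw [List.replicate_succ]; exact List.prefix_append _ _
    have h2 := congrArg mk (append_eq_append_of_flatten hTl.symm h1 hqT (by nlinarith))
    rw [mk_append, mk_append] at h2
    refine ⟨-1 - k, commute_inl_of_conj_eq ?_⟩
    have h3 : mk ((List.replicate (m + 1) S).flatten ++ (w' ++ S)) ^ (-1 - k) * h.left =
        (mk q)⁻¹ := by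
      rw [← hfl, hk, zpow_sub, mul_assoc, inv_mul_cancel_left, hp, mk_append]; group
    rw [(inl_zpow_mul_left _ _ _).1, (inl_zpow_mul_left _ _ _).2, h3, permAut_mk, ← hT, mul_assoc,
      inv_inv, ← h2]
    group

theorem exists_pow_forall_commute_aux {S : List (X × Bool)} (hS : IsReduced (S ++ S))
    (hS0 : S ≠ []) (x y : FreeGroup X) :
    ∃ n : ℕ, ∀ h : PermProd P X, h * inl (mk S ^ n * x) * h⁻¹ = inl (mk S ^ n * y) →
      ∃ k : ℤ, Commute (inl (mk S ^ n * y) ^ k * h) (inl (mk S)) := by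
  obtain ⟨p₁, hp₁⟩ := exists_sandwich hS hS0 x
  obtain ⟨p₂, hp₂⟩ := exists_sandwich hS hS0 y
  set p := max p₁ p₂
  obtain ⟨w, hw, hwx⟩ := hp₁ p (le_max_left _ _)
  obtain ⟨w', hw', hwy⟩ := hp₂ p (le_max_right _ _)
  set s := mk S with hs
  have hx : ∀ m (x : FreeGroup X) (w : List (X × Bool)), s ^ p * x * s ^ p = mk (S ++ w ++ S) →
      s ^ m * mk (w ++ S) = (s ^ p)⁻¹ * (s ^ (m - 1 + 2 * p) * x) * s ^ p ∨ m = 0 := by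
    intro m x w hw
    rcases m with _ | m
    · exact Or.inr rfl
    left
    rw [List.append_assoc, mk_append, ← hs] at hw
    have : mk (w ++ S) = s⁻¹ * (s ^ p * x * s ^ p) := by rw [hw]; group
    rw [this]
    rw [show m + 1 - 1 + 2 * p = p + m + p by omega, pow_add, pow_add, pow_succ]
    group
  have hx1 := (hx (w.length + 4) x w hwx).resolve_right (by omega)
  have hy1 := (hx (w.length + 4) y w' hwy).resolve_right (by omega)
  refine ⟨w.length + 4 - 1 + 2 * p, fun h hh => ?_⟩
  set c : PermProd P X := inl (s ^ p) with hc
  obtain ⟨k, hk⟩ := exists_commute_of_conj_word hS hS0 hw hw' le_rfl (h := c⁻¹ * h * c) (by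
    rw [← hs, hx1, hy1]
    simp only [map_mul, map_inv, ← hc] at hh ⊢
    rw [← hh]; group)
  refine ⟨k, ?_⟩
  rw [← hs, hy1] at hk
  have h1 : (inl ((s ^ p)⁻¹ * (s ^ (w.length + 4 - 1 + 2 * p) * y) * s ^ p) : PermProd P X) ^ k *
      (c⁻¹ * h * c) = c⁻¹ * (inl (s ^ (w.length + 4 - 1 + 2 * p) * y) ^ k * h) * c := by
    have h2 : (inl ((s ^ p)⁻¹ * (s ^ (w.length + 4 - 1 + 2 * p) * y) * s ^ p) : PermProd P X) =
        c⁻¹ * (inl (s ^ (w.length + 4 - 1 + 2 * p) * y)) * c⁻¹⁻¹ := by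
      simp only [map_mul, map_inv, ← hc, inv_inv]
    rw [h2, conj_zpow]; group
  rw [h1] at hk
  have h3 : (inl s : PermProd P X) = c⁻¹ * inl s * c := by
    rw [hc, ← map_inv, ← map_mul, ← map_mul]
    congr 1; group
  rw [h3] at hk
  refine (Commute.conj_iff c⁻¹).1 ?_
  rwa [inv_inv]

/-- For fixed `s ≠ 1`, `x`, `y` in the free factor and a suitable exponent `n`, every element
conjugating `s ^ n * x` to `s ^ n * y` commutes with `s` up to a power of the target. -/
theorem exists_pow_forall_commute {s : FreeGroup X} (hs : s ≠ 1) (x y : FreeGroup X) :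
    ∃ n : ℕ, ∀ h : PermProd P X, h * inl (s ^ n * x) * h⁻¹ = inl (s ^ n * y) →
      ∃ k : ℤ, Commute (inl (s ^ n * y) ^ k * h) (inl s) := by
  obtain ⟨c, S, hS, hS0, rfl⟩ := exists_conj_cyclicallyReduced hs
  obtain ⟨n, hn⟩ := exists_pow_forall_commute_aux (P := P) hS hS0 (c⁻¹ * x * c) (c⁻¹ * y * c)
  refine ⟨n, fun h hh => ?_⟩
  have hx : ∀ x, (c * mk S * c⁻¹) ^ n * x = c * (mk S ^ n * (c⁻¹ * x * c)) * c⁻¹ := by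
    intro x; rw [conj_pow]; group
  rw [hx, hx] at hh
  set d : PermProd P X := inl c with hd
  obtain ⟨k, hk⟩ := hn (d⁻¹ * h * d) (by
    simp only [map_mul, map_inv, ← hd] at hh ⊢
    have : ∀ a b : PermProd P X, h * (d * a * d⁻¹) * h⁻¹ = d * b * d⁻¹ →
        d⁻¹ * h * d * a * (d⁻¹ * h * d)⁻¹ = b := by
      intro a b hab
      calc _ = d⁻¹ * (h * (d * a * d⁻¹) * h⁻¹) * d := by group
        _ = b := by rw [hab]; group
    exact this _ _ hh)
  refine ⟨k, ?_⟩
  have h1 : (inl ((c * mk S * c⁻¹) ^ n * y) : PermProd P X) ^ k * h =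
      d * (inl (mk S ^ n * (c⁻¹ * y * c)) ^ k * (d⁻¹ * h * d)) * d⁻¹ := by
    rw [hx]
    have h2 : (inl (c * (mk S ^ n * (c⁻¹ * y * c)) * c⁻¹) : PermProd P X) =
      d * (inl (mk S ^ n * (c⁻¹ * y * c))) * d⁻¹ := by rw [map_mul, map_mul, map_inv]
    rw [h2, conj_zpow]; group
  rw [h1]
  have h3 : (inl (c * mk S * c⁻¹) : PermProd P X) = d * inl (mk S) * d⁻¹ := by
    rw [map_mul, map_mul, map_inv]
  rw [h3]
  exact (Commute.conj_iff d).2 hk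

end PermProd

end

section

open FreeGroup hiding map_one map_mul map_inv map
open SemidirectProduct hiding map

theorem Commute.of_pow_left {G : Type*} [Group G] [IsMulTorsionFree G] {x y : G} {k : ℕ}
    (hk : k ≠ 0) (h : Commute (x ^ k) y) : Commute x y := by
  have h1 : (y * x * y⁻¹) ^ k = x ^ k := by
    rw [conj_pow, ← h.eq]; group
  have h2 := pow_left_injective hk h1
  rw [commute_iff_eq]
  nth_rewrite 1 [← h2]
  group

theorem Commute.of_zpow_left {G : Type*} [Group G] [IsMulTorsionFree G] {x y : G} {k : ℤ}
    (hk : k ≠ 0) (h : Commute (x ^ k) y) : Commute x y := by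
  obtain ⟨n, rfl | rfl⟩ := k.eq_nat_or_neg
  · exact Commute.of_pow_left (k := n) (by omega) (by simpa using h)
  · exact Commute.of_pow_left (k := n) (by omega) (by simpa using h)

/-- An element fixing a power orbit of a point already fixes the point. -/
def RootStable (P X : Type*) [Group P] [MulAction P X] : Prop :=
  ∀ (p : P) (x : X) (k : ℕ), k ≠ 0 → p ^ k • x = x → p • x = x

namespace PermProd

variable {P X : Type*} [Group P] [MulAction P X]

theorem right_pow (h : PermProd P X) (k : ℕ) : (h ^ k).right = h.right ^ k :=
  map_pow (rightHom : PermProd P X →* P) h k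

theorem exists_rotation_of_commute {S : List (X × Bool)} (hS : IsReduced (S ++ S)) (hS0 : S ≠ [])
    {h : PermProd P X} (hc : Commute h (inl (mk S))) :
    ∃ (k : ℤ) (p q : List (X × Bool)), S = p ++ q ∧
      (S.map fun x => (h.right • x.1, x.2)) = q ++ p ∧ h.left = mk S ^ k * mk p := by
  obtain ⟨f, hf, hfl⟩ := exists_isReduced_mk h.left
  have h1 := conj_eq_of_commute_inl hc
  rw [permAut_mk, ← hfl] at h1
  obtain ⟨k, p, q, h2, h3, h4⟩ := exists_rotation f hf
    (by simpa using hS.smul h.right) hS (by simpa using hS0) h1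
  exact ⟨k, p, q, h2, h3, hfl ▸ h4⟩

theorem exists_pow_eq_of_commute_mk {S : List (X × Bool)} (hS : IsReduced (S ++ S))
    (hS0 : S ≠ []) {h : PermProd P X} (hc : Commute h (inl (mk S))) :
    ∃ (i j : ℕ) (k l : ℤ) (p : FreeGroup X), i < j ∧ (h ^ i).left = mk S ^ k * p ∧
      (h ^ j).left = mk S ^ l * p ∧
      permAut P X (h.right ^ i) (mk S) = permAut P X (h.right ^ j) (mk S) := by
  choose k p q h1 h2 h3 using fun i : ℕ => exists_rotation_of_commute hS hS0 (hc.pow_left i)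
  have hp : ∀ i, (p i).length < S.length + 1 := fun i => by
    have := congrArg List.length (h1 i)
    rw [List.length_append] at this; omega
  obtain ⟨i, j, hij, he⟩ := Finite.exists_ne_map_eq_of_infinite
    (fun i => (⟨(p i).length, hp i⟩ : Fin (S.length + 1)))
  have he' : (p i).length = (p j).length := congrArg Fin.val he
  obtain ⟨hpe, hqe⟩ := List.append_inj ((h1 i).symm.trans (h1 j)) he'
  have h4 : permAut P X (h.right ^ i) (mk S) = permAut P X (h.right ^ j) (mk S) := by
    rw [permAut_mk, permAut_mk, ← right_pow, ← right_pow, h2 i, h2 j, hpe, hqe]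
  rcases lt_or_gt_of_ne hij with hlt | hlt
  · exact ⟨i, j, k i, k j, mk (p i), hlt, h3 i, by rw [h3 j, hpe], h4⟩
  · exact ⟨j, i, k j, k i, mk (p i), hlt, by rw [h3 j, hpe], h3 i, h4.symm⟩

end PermProd

/-- In a free group, commuting elements have common powers. -/
theorem FreeGroup.exists_pow_eq_zpow_of_commute {X : Type*} {y g : FreeGroup X}
    (hc : Commute y g) (hg : g ≠ 1) : ∃ (m : ℕ) (t : ℤ), m ≠ 0 ∧ y ^ m = g ^ t := by
  obtain ⟨c, S, hS, hS0, rfl⟩ := exists_conj_cyclicallyReduced hg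
  have h1 : Commute (inl (c⁻¹ * y * c) : PermProd (Equiv.Perm X) X) (inl (mk S)) := by
    refine Commute.map ?_ _
    have h2 : mk S = c⁻¹ * (c * mk S * c⁻¹) * c := by group
    rw [h2]
    simpa using (Commute.conj_iff c⁻¹).2 hc
  obtain ⟨i, j, k, l, p, hij, h3, h4, -⟩ := PermProd.exists_pow_eq_of_commute_mk hS hS0 h1
  rw [← map_pow, left_inl] at h3 h4
  refine ⟨j - i, l - k, by omega, ?_⟩
  rw [conj_zpow, zpow_sub]
  have h5 : y = c * (c⁻¹ * y * c) * c⁻¹ := by group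
  rw [h5, conj_pow, pow_sub _ hij.le, h3, h4]
  group

namespace PermProd

variable {P X : Type*} [Group P] [MulAction P X]

theorem left_pow_of_permAut_eq {h : PermProd P X} (hh : permAut P X h.right h.left = h.left)
    (a : ℕ) : (h ^ a).left = h.left ^ a := by
  induction a with
  | zero => simp
  | succ a ih => rw [pow_succ', mul_left, ih, map_pow, hh, pow_succ']

theorem exists_left_eq_one_of_commute_mk {S : List (X × Bool)} (hS : IsReduced (S ++ S))
    (hS0 : S ≠ []) {h : PermProd P X} (hc : Commute h (inl (mk S))) :
    ∃ (m : ℕ) (t : ℤ), m ≠ 0 ∧ ((inl (mk S)) ^ t * h ^ m).left = 1 := by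
  have hs1 : mk S ≠ 1 := fun h0 => hS0 (hS.left.eq_of_mk_eq IsReduced.nil h0)
  obtain ⟨i, j, -, -, -, hij, -, -, h4⟩ := exists_pow_eq_of_commute_mk hS hS0 hc
  set m := j - i with hm
  have h5 : permAut P X (h ^ m).right (mk S) = mk S := by
    rw [right_pow, hm, pow_sub _ hij.le, (Commute.refl h.right).pow_pow j i |>.inv_right.eq,
      map_mul, MulAut.mul_apply, ← h4, ← MulAut.mul_apply, ← map_mul, inv_mul_cancel, map_one,
      MulAut.one_apply]
  set f := (h ^ m).left with hf
  have h6 : Commute f (mk S) := by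
    have := conj_eq_of_commute_inl (hc.pow_left m)
    rw [h5, ← hf] at this
    rw [commute_iff_eq]
    nth_rewrite 2 [← this]
    group
  obtain ⟨a, b, ha, hab⟩ := exists_pow_eq_zpow_of_commute h6 hs1
  have h7 : permAut P X (h ^ m).right f = f := by
    refine pow_left_injective ha ?_
    dsimp only
    rw [← map_pow, hab, map_zpow, h5]
  refine ⟨m * a, -b, by simp [ha]; omega, ?_⟩
  rw [(inl_zpow_mul_left _ _ _).1, pow_mul, left_pow_of_permAut_eq h7, ← hf, hab, ← zpow_add]
  simp

theorem fixAt_mul {q : FreeGroup X} {g h : PermProd P X} (hg : FixAt q g) (hh : FixAt q h) :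
    FixAt q (g * h) := by
  have : (inl q)⁻¹ * (g * h) * inl q = ((inl q)⁻¹ * g * inl q) * ((inl q)⁻¹ * h * inl q) := by
    group
  rw [FixAt] at *
  rw [this, mul_left, hg, hh, map_one, one_mul]

theorem fixAt_pow {q : FreeGroup X} {g : PermProd P X} (hg : FixAt q g) (n : ℕ) :
    FixAt q (g ^ n) := by
  induction n with
  | zero => simp [FixAt]
  | succ n ih => rw [pow_succ]; exact fixAt_mul ih hg

theorem fixAt_inv {q : FreeGroup X} {g : PermProd P X} (hg : FixAt q g) : FixAt q g⁻¹ := by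
  have : (inl q)⁻¹ * g⁻¹ * inl q = ((inl q)⁻¹ * g * inl q)⁻¹ := by group
  rw [FixAt] at *
  rw [this, inv_left, hg, inv_one, map_one]

/-- For a nontrivial element `s` of the free factor there is a vertex such that every element
commuting with `s` has a power which fixes that vertex up to a power of `s`. -/
theorem exists_fixAt_of_commute {s : FreeGroup X} (hs : s ≠ 1) : ∃ q : FreeGroup X,
    ∀ h : PermProd P X, Commute h (inl s) →
      ∃ (m : ℕ) (t : ℤ), m ≠ 0 ∧ FixAt q ((inl s) ^ t * h ^ m) := by
  obtain ⟨c, S, hS, hS0, rfl⟩ := exists_conj_cyclicallyReduced hs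
  refine ⟨c, fun h hc => ?_⟩
  set d : PermProd P X := inl c with hd
  have h1 : (inl (c * mk S * c⁻¹) : PermProd P X) = d * inl (mk S) * d⁻¹ := by
    rw [map_mul, map_mul, map_inv]
  rw [h1] at hc ⊢
  have h2 : Commute (d⁻¹ * h * d) (inl (mk S)) := by
    refine (Commute.conj_iff d).1 ?_
    have : d * (d⁻¹ * h * d) * d⁻¹ = h := by group
    rwa [this]
  obtain ⟨m, t, hm, ht⟩ := exists_left_eq_one_of_commute_mk hS hS0 h2
  refine ⟨m, t, hm, ?_⟩
  rw [FixAt, ← ht, ← hd, conj_zpow]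
  have : (d⁻¹ * h * d) ^ m = d⁻¹ * h ^ m * d := by
    have := conj_pow (a := d⁻¹) (b := h) (i := m)
    rwa [inv_inv] at this
  rw [this]
  congr 1
  group

theorem permAut_eq_self_of_pow (hX : RootStable P X) {p : P} {w : FreeGroup X} {k : ℕ}
    (hk : k ≠ 0) (h : permAut P X (p ^ k) w = w) : permAut P X p w = w := by
  rw [permAut_eq_self_iff] at h ⊢
  exact fun i hi => hX p i k hk (h i hi)

theorem fixAt_inr_iff {q : FreeGroup X} {a : P} :
    FixAt q (inr a : PermProd P X) ↔ permAut P X a q = q := by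
  rw [FixAt, ← map_inv]
  simp only [mul_left, left_inl, right_inl, left_inr, right_inr, map_one, mul_right, one_mul,
    mul_one]
  rw [inv_mul_eq_one, eq_comm]

theorem fixAt_mul_iff {q r : FreeGroup X} {h : PermProd P X} :
    FixAt (q * r) h ↔ FixAt r ((inl q)⁻¹ * h * inl q) := by
  rw [FixAt, FixAt, map_mul]
  have : (inl q * inl r)⁻¹ * h * (inl q * inl r) =
    (inl r)⁻¹ * ((inl q)⁻¹ * h * inl q) * inl r := by group
  rw [this]

theorem FixAt.of_pow (hX : RootStable P X) {q : FreeGroup X} {h : PermProd P X} {k : ℕ}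
    (hk : k ≠ 0) (hh : FixAt q (h ^ k)) : FixAt q h := by
  obtain ⟨p, hp⟩ := (hh.bdd.of_pow hk).exists_fixAt
  obtain ⟨r, rfl⟩ : ∃ r, q = p * r := ⟨p⁻¹ * q, by group⟩
  rw [fixAt_mul_iff] at hh ⊢
  have h1 := eq_inr_of_left_eq_one hp
  have h2 : (inl p)⁻¹ * h ^ k * inl p = ((inl p)⁻¹ * h * inl p) ^ k := by
    have := conj_pow (a := (inl p)⁻¹) (b := h) (i := k)
    rw [inv_inv] at this
    exact this.symm
  rw [h2, h1, ← map_pow, fixAt_inr_iff] at hh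
  rw [h1, fixAt_inr_iff]
  exact permAut_eq_self_of_pow hX hk hh

/-- An element commuting with two noncommuting elements of the free factor is bounded. -/
theorem bdd_of_commute_of_not_commute (hX : RootStable P X) {n n' : FreeGroup X}
    {z : PermProd P X} (h : Commute z (inl n)) (h' : Commute z (inl n')) (hn : ¬ Commute n n') :
    Bdd z := by
  have hn1 : n ≠ 1 := by rintro rfl; exact hn (Commute.one_left _)
  obtain ⟨q, hq⟩ := exists_fixAt_of_commute (P := P) hn1
  obtain ⟨m, t, hm, he⟩ := hq z h
  rcases eq_or_ne t 0 with rfl | ht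
  · rw [zpow_zero, one_mul] at he
    exact he.bdd.of_pow hm
  exfalso
  apply hn
  refine Commute.of_zpow_left ht ?_
  set c : PermProd P X := inl q with hc
  have h1 := eq_inr_of_left_eq_one he
  set a := ((inl q)⁻¹ * (inl n ^ t * z ^ m) * inl q).right
  set n0 := q⁻¹ * n * q with hn0
  set n1 := q⁻¹ * n' * q with hn1
  have key : ∀ k : ℕ, permAut P X (a ^ k) n1 = n0 ^ (t * k) * n1 * (n0 ^ (t * k))⁻¹ := by
    intro k
    apply inl_injective (φ := permAut P X)
    have h0 : (inr (a ^ k) : PermProd P X) = (c⁻¹ * (inl n ^ t * z ^ m) * c) ^ k := by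
      rw [map_pow, ← h1]
    rw [inl_aut, map_inv, h0]
    have h2 : (inl n0 : PermProd P X) = c⁻¹ * inl n * c := by
      rw [hn0, map_mul, map_mul, map_inv]
    have h3 : (inl n1 : PermProd P X) = c⁻¹ * inl n' * c := by
      rw [hn1, map_mul, map_mul, map_inv]
    have h4 : ∀ (x : PermProd P X) (k : ℤ), (c⁻¹ * x * c) ^ k = c⁻¹ * x ^ k * c := by
      intro x k
      have := conj_zpow (a := c⁻¹) (b := x) (i := k)
      rwa [inv_inv] at this
    have h5 : (inl n ^ t * z ^ m) ^ k = inl n ^ (t * k) * z ^ (m * k) := by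
      rw [((h.symm.zpow_left t).pow_right m).mul_pow, ← pow_mul, zpow_mul, zpow_natCast]
    have h6 : z ^ (m * k) * inl n' * (z ^ (m * k))⁻¹ = inl n' := by
      rw [(h'.pow_left (m * k)).eq]; group
    have h7 : (inl (n0 ^ (t * k) * n1 * (n0 ^ (t * k))⁻¹) : PermProd P X) =
        inl n0 ^ (t * k) * inl n1 * (inl n0 ^ (t * k))⁻¹ := by
      rw [map_mul, map_mul, map_inv, map_zpow]
    rw [h7, h2, h3, ← zpow_natCast, h4, zpow_natCast, h5, h4]
    calc _ = c⁻¹ * (inl n ^ (t * k) * (z ^ (m * k) * inl n' * (z ^ (m * k))⁻¹) *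
          (inl n ^ (t * k))⁻¹) * c := by group
      _ = _ := by rw [h6]; group
  have h7 : permAut P X a n1 = n1 := by
    rw [permAut_eq_self_iff]
    intro i hi
    have h8 : ∀ k : ℕ, a ^ k • i ∈ letters n0 ∪ letters n1 := by
      intro k
      have h9 := letters_permAut (a ^ k) n1 hi
      rw [key k] at h9
      rcases letters_mul _ _ h9 with h10 | h10
      · rcases letters_mul _ _ h10 with h11 | h11
        · exact Or.inl (letters_zpow _ _ h11)
        · exact Or.inr h11
      · rw [letters_inv] at h10
        exact Or.inl (letters_zpow _ _ h10)
    have hfin : Finite ↥(letters n0 ∪ letters n1) :=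
      ((letters_finite n0).union (letters_finite n1)).to_subtype
    obtain ⟨k, l, hkl, hkl'⟩ := Finite.exists_ne_map_eq_of_infinite
      (fun k : ℕ => (⟨a ^ k • i, h8 k⟩ : ↥(letters n0 ∪ letters n1)))
    have hkl2 : a ^ k • i = a ^ l • i := congrArg Subtype.val hkl'
    wlog hlt : k < l generalizing k l
    · exact this l k hkl.symm hkl'.symm hkl2.symm (by omega)
    refine hX a i (l - k) (by omega) ?_
    have h12 : a ^ l = a ^ k * a ^ (l - k) := by rw [← pow_add]; congr 1; omega
    rw [h12, mul_smul] at hkl2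
    exact (smul_left_cancel _ hkl2).symm
  have h8 := key 1
  rw [pow_one, h7] at h8
  simp only [Nat.cast_one, mul_one] at h8
  have h9 : Commute (n0 ^ t) n1 := by
    rw [commute_iff_eq]
    nth_rewrite 2 [h8]
    group
  have h10 : n0 ^ t = q⁻¹ * n ^ t * q := by
    have := conj_zpow (a := q⁻¹) (b := n) (i := t)
    rwa [inv_inv] at this
  rw [h10] at h9
  refine (Commute.conj_iff q⁻¹).1 ?_
  rwa [inv_inv]

end PermProd

end

section

open FreeGroup hiding map_one map_mul map_inv map
open SemidirectProduct hiding map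

/-- A group in which an element commuting with one of its conjugates commutes with the
conjugator. -/
def ConjCommute (G : Type*) [Group G] : Prop :=
  ∀ x z : G, Commute z (x * z * x⁻¹) → Commute z x

theorem eq_inl_of_right_eq_one {N P : Type*} [Group N] [Group P] {φ : P →* MulAut N}
    {h : N ⋊[φ] P} (hh : h.right = 1) : h = inl h.left := by
  ext <;> simp [hh]

namespace PermProd

variable {P X : Type*} [Group P] [MulAction P X]

theorem exists_inl_eq_conj (x : PermProd P X) (n : FreeGroup X) :
    ∃ n', inl n' = x * inl n * x⁻¹ := ⟨_, (conj_inl x n).symm⟩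

theorem commute_inl_iff {n n' : FreeGroup X} :
    Commute (inl n : PermProd P X) (inl n') ↔ Commute n n' := by
  constructor
  · intro h
    apply inl_injective (φ := permAut P X)
    rw [map_mul, map_mul]; exact h
  · exact fun h => h.map _

theorem FixAt.eq_one {q n : FreeGroup X} (h : FixAt q (inl n : PermProd P X)) : n = 1 :=
  eq_one_of_bdd_inl h.bdd

/-- Uniqueness of roots passes from the permuting group to the semidirect product. -/
theorem isMulTorsionFree [IsMulTorsionFree P] (hX : RootStable P X) :
    IsMulTorsionFree (PermProd P X) := by
  refine ⟨fun k hk x y hxy => ?_⟩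
  replace hxy : x ^ k = y ^ k := hxy
  have hr : x.right = y.right := by
    apply pow_left_injective hk
    dsimp only
    rw [← right_pow, hxy, right_pow]
  set n := (x⁻¹ * y).left with hn
  have hxn : x⁻¹ * y = inl n := eq_inl_of_right_eq_one (by simp [hr])
  have hzx : Commute (x ^ k) x := Commute.pow_self x k
  have hzy : Commute (x ^ k) y := by rw [hxy]; exact Commute.pow_self y k
  have hzn : Commute (x ^ k) (inl n) := by
    rw [← hxn]; exact hzx.inv_right.mul_right hzy
  suffices h : n = 1 by
    rw [h, map_one, inv_mul_eq_one] at hxn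
    exact hxn
  by_cases hb : Bdd (x ^ k)
  · obtain ⟨q, hq⟩ := (Bdd.of_pow hk (hxy ▸ hb)).exists_fixAt
    have h1 : FixAt q (x ^ k) := hxy ▸ fixAt_pow hq k
    have h2 := fixAt_mul (fixAt_inv (h1.of_pow hX hk)) hq
    rw [hxn] at h2
    exact h2.eq_one
  by_contra hn1
  obtain ⟨q, hq⟩ := exists_fixAt_of_commute (P := P) hn1
  obtain ⟨m, t, hm, he⟩ := hq _ hzn
  obtain ⟨n', hn'⟩ := exists_inl_eq_conj x n
  have hzn' : Commute (x ^ k) (inl n') := by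
    rw [hn']; exact (hzx.mul_right hzn).mul_right hzx.inv_right
  have hc : Commute n n' := by
    by_contra hc
    exact hb (bdd_of_commute_of_not_commute hX hzn hzn' hc)
  have ht : t ≠ 0 := by
    rintro rfl
    rw [zpow_zero, one_mul] at he
    exact hb (he.bdd.of_pow hm)
  set z := x ^ k
  have he' := he.bdd.conj x
  have h1 : x * (inl n ^ t * z ^ m) * x⁻¹ = inl n' ^ t * z ^ m := by
    rw [hn', conj_zpow]
    have : x * (inl n ^ t * z ^ m) * x⁻¹ = x * inl n ^ t * (z ^ m * x⁻¹) := by group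
    rw [this, (hzx.inv_right.pow_left m).eq]; group
  rw [h1] at he'
  have hnn : Commute (inl n' : PermProd P X) (inl n) := commute_inl_iff.2 hc.symm
  have hcz : Commute (inl n' ^ t * z ^ m) (inl n ^ t * z ^ m) :=
    (((hnn.zpow_zpow t t).mul_right ((hzn'.symm.pow_right m).zpow_left t))).mul_left
      (((hzn.pow_left m).zpow_right t).mul_right (Commute.refl _))
  have h2 := he'.mul he.bdd.inv hcz.inv_right
  have h3 : inl n' ^ t * z ^ m * (inl n ^ t * z ^ m)⁻¹ =
      (inl (n' ^ t * (n ^ t)⁻¹) : PermProd P X) := by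
    rw [map_mul, map_inv, map_zpow, map_zpow]; group
  rw [h3] at h2
  have h4 := mul_inv_eq_one.1 (eq_one_of_bdd_inl h2)
  have h5 : n' = n := zpow_left_injective ht h4
  rw [h5] at hn'
  have hxn' : Commute x (inl n) := by
    rw [commute_iff_eq]
    nth_rewrite 2 [hn']
    group
  have h6 : (inl n : PermProd P X) ^ k = 1 := by
    have : y = x * inl n := by rw [← hxn]; group
    have h7 := hxy
    rw [this, hxn'.mul_pow] at h7
    exact mul_left_cancel (a := x ^ k) (by rw [mul_one]; exact h7.symm)
  rw [← map_pow, ← map_one (inl : FreeGroup X →* PermProd P X), inl_inj] at h6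
  exact hn1 (pow_left_injective hk (by simpa using h6))

theorem natAbs_eq_of_linear_bound {a b l C : ℕ} (hl : 0 < l)
    (h : ∀ j : ℕ, a * j * l ≤ b * j * l + C) : a ≤ b := by
  by_contra! hab
  have h1 := h (C + 1)
  obtain ⟨d, rfl⟩ : ∃ d, a = b + 1 + d := ⟨a - b - 1, by omega⟩
  have h2 : C + 1 ≤ (C + 1) * l := Nat.le_mul_of_pos_right _ hl
  have h3 : (b + 1 + d) * (C + 1) * l = b * (C + 1) * l + (C + 1) * l + d * (C + 1) * l := by ring
  have h4 : 0 ≤ d * (C + 1) * l := Nat.zero_le _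
  omega

theorem natAbs_le_of_conj {n n' : FreeGroup X} (hn : n ≠ 1) {x : PermProd P X}
    (hx : inl n' = x * inl n * x⁻¹) {t r : ℤ} (h : n' ^ t = n ^ r) : r.natAbs = t.natAbs := by
  obtain ⟨l, c, hl, hlc⟩ := exists_wordLength_zpow n
  have key : ∀ j : ℕ, inl (n ^ (r * j)) = x * inl (n ^ (t * j)) * x⁻¹ := by
    intro j
    rw [zpow_mul, ← h, ← zpow_mul, map_zpow, map_zpow, hx, conj_zpow]
  refine le_antisymm (natAbs_eq_of_linear_bound (C := 2 * c + 2 * len x) (hl hn) fun j => ?_)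
    (natAbs_eq_of_linear_bound (C := 2 * c + 2 * len x) (hl hn) fun j => ?_)
  · have h1 := len_mul_le (x * inl (n ^ (t * j))) x⁻¹
    have h2 := len_mul_le x (inl (n ^ (t * j)))
    rw [← key j] at h1
    rw [len_inl] at h1 h2
    rw [len_inv] at h1
    have h3 := (hlc (r * j)).1
    have h4 := (hlc (t * j)).2
    rw [Int.natAbs_mul, Int.natAbs_natCast] at h3 h4
    omega
  · have h0 : inl (n ^ (t * j)) = x⁻¹ * inl (n ^ (r * j)) * x := by rw [key j]; group
    have h1 := len_mul_le (x⁻¹ * inl (n ^ (r * j))) x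
    have h2 := len_mul_le x⁻¹ (inl (n ^ (r * j)))
    rw [← h0] at h1
    rw [len_inl] at h1 h2
    rw [len_inv] at h2
    have h3 := (hlc (r * j)).2
    have h4 := (hlc (t * j)).1
    rw [Int.natAbs_mul, Int.natAbs_natCast] at h3 h4
    omega

/-- The commutation property `ConjCommute` passes from the permuting group to the semidirect
product. -/
theorem conjCommute [IsMulTorsionFree P] (hX : RootStable P X) (hP : ConjCommute P) :
    ConjCommute (PermProd P X) := by
  have := isMulTorsionFree hX
  intro x z hz
  have hr : Commute z.right x.right := hP _ _ (by simpa using hz.map rightHom)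
  set y := x * z * x⁻¹ with hy
  set n := (y * z⁻¹).left with hn
  have hyz : y * z⁻¹ = inl n := by
    refine eq_inl_of_right_eq_one ?_
    have : (y * z⁻¹).right = x.right * z.right * x.right⁻¹ * z.right⁻¹ := by simp [hy]
    rw [this, ← hr.eq]; group
  have hzn : Commute z (inl n) := by rw [← hyz]; exact hz.mul_right (Commute.refl z).inv_right
  have hyn : Commute y (inl n) := by rw [← hyz]; exact (Commute.refl y).mul_right hz.symm.inv_right
  suffices h : n = 1 by
    rw [h, map_one, mul_inv_eq_one, hy, mul_inv_eq_iff_eq_mul] at hyz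
    exact hyz.symm
  by_contra hn1
  obtain ⟨q, hq⟩ := exists_fixAt_of_commute (P := P) hn1
  obtain ⟨m, t, hm, he⟩ := hq _ hzn
  obtain ⟨n', hn'⟩ := exists_inl_eq_conj x n
  have hyn' : Commute y (inl n') := by
    rw [hn', hy]; exact (Commute.conj_iff x).2 hzn
  by_cases hc : Commute n n'
  swap
  · have h1 := bdd_of_commute_of_not_commute hX hyn hyn' hc
    have h2 : Bdd z := (bdd_conj_iff x).1 h1
    have h3 := h1.mul h2.inv hz.symm.inv_right
    rw [hyz] at h3
    exact hn1 (eq_one_of_bdd_inl h3)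
  have hnn : Commute (inl n' : PermProd P X) (inl n) := commute_inl_iff.2 hc.symm
  have hzy : z = (inl n)⁻¹ * y := by rw [← hyz]; group
  have hzn' : Commute z (inl n') := by
    rw [hzy]; exact hnn.symm.inv_left.mul_left hyn'
  have he' := he.bdd.conj x
  have h1 : x * (inl n ^ t * z ^ m) * x⁻¹ = inl n' ^ t * (inl n ^ m * z ^ m) := by
    have h2 : y = inl n * z := by rw [← hyz]; group
    rw [← hzn.symm.mul_pow, ← h2, hn', conj_zpow, hy, conj_pow]
    group
  rw [h1] at he'
  have hcz : Commute (inl n' ^ t * (inl n ^ m * z ^ m)) (inl n ^ t * z ^ m) := by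
    refine Commute.mul_left ?_ (Commute.mul_left ?_ ?_)
    · exact ((hnn.zpow_zpow t t).mul_right ((hzn'.symm.pow_right m).zpow_left t))
    · exact (((Commute.refl (inl n)).pow_left m).zpow_right t).mul_right
        (hzn.symm.pow_pow m m)
    · exact ((hzn.pow_left m).zpow_right t).mul_right (Commute.refl _)
  have h2 := he'.mul he.bdd.inv hcz.inv_right
  have h3 : inl n' ^ t * (inl n ^ m * z ^ m) * (inl n ^ t * z ^ m)⁻¹ =
      (inl (n' ^ t * (n ^ m * (n ^ t)⁻¹)) : PermProd P X) := by
    rw [map_mul, map_mul, map_inv, map_zpow, map_zpow, map_pow]; group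
  rw [h3] at h2
  have h4 : n' ^ t = n ^ (t - m) := by
    have h5 := eq_one_of_bdd_inl h2
    rw [mul_eq_one_iff_eq_inv] at h5
    rw [h5, zpow_sub, zpow_natCast]; group
  have h5 := natAbs_le_of_conj hn1 hn' h4
  have h6 : t - m = -t ∧ t ≠ 0 := by omega
  rw [h6.1, zpow_neg, ← inv_zpow] at h4
  have h7 : n' = n⁻¹ := zpow_left_injective h6.2 h4
  have h8 : (inl n : PermProd P X) = 1 :=
    eq_one_of_conj_eq_inv (z := x) (by rw [← hn', h7, map_inv])
  exact hn1 (inl_injective (φ := permAut P X) (by rw [h8, map_one]))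

end PermProd

end

section

open FreeGroup hiding map_one map_mul map_inv map
open SemidirectProduct hiding map

/-- Pointwise stabilisers of arbitrary sets are pointwise stabilisers of finite subsets. -/
def FinitelyDetermined (P X : Type*) [Group P] [MulAction P X] : Prop :=
  ∀ Y : Set X, ∃ Y₀ ⊆ Y, Y₀.Finite ∧
    ∀ p : P, (∀ x ∈ Y₀, p • x = x) → ∀ x ∈ Y, p • x = x

namespace PermProd

variable {P X : Type*} [Group P] [MulAction P X]

theorem exists_finite_fixAt (hD : FinitelyDetermined P X) (Q : Set (FreeGroup X)) :
    ∃ Q₀ ⊆ Q, Q₀.Finite ∧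
      ∀ h : PermProd P X, (∀ q ∈ Q₀, FixAt q h) → ∀ q ∈ Q, FixAt q h := by
  rcases Q.eq_empty_or_nonempty with rfl | ⟨q₀, hq₀⟩
  · exact ⟨∅, subset_rfl, Set.finite_empty, by simp⟩
  obtain ⟨Z, hZ, hZf, hZD⟩ := hD (⋃ q ∈ Q, letters (q₀⁻¹ * q))
  have hch : ∀ z ∈ Z, ∃ q ∈ Q, z ∈ letters (q₀⁻¹ * q) := fun z hz => by
    simpa using hZ hz
  choose! r hrQ hrl using hch
  refine ⟨insert q₀ (r '' Z), Set.insert_subset hq₀ (Set.image_subset_iff.2 hrQ),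
    (hZf.image r).insert q₀, fun h hh => ?_⟩
  have h0 : ((inl q₀)⁻¹ * h * inl q₀).left = 1 := hh q₀ (Set.mem_insert _ _)
  have key : ∀ q, FixAt q h ↔ ∀ i ∈ letters (q₀⁻¹ * q),
      ((inl q₀)⁻¹ * h * inl q₀).right • i = i := fun q => by
    rw [← permAut_eq_self_iff, ← fixAt_inr_iff, ← eq_inr_of_left_eq_one h0, ← fixAt_mul_iff,
      mul_inv_cancel_left]
  intro q hq
  rw [key]
  refine fun i hi => hZD _ (fun z hz => ?_) i (Set.mem_biUnion hq hi)
  exact (key (r z)).1 (hh _ (Set.mem_insert_of_mem _ ⟨z, hz, rfl⟩)) z (hrl z hz)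

theorem fixAt_mul_inl_iff {n q : FreeGroup X} {h : PermProd P X} (hq : FixAt q h) :
    FixAt (n * q) h ↔ Commute h (inl n) := by
  rw [fixAt_mul_iff]
  constructor
  · intro h1
    have h2 := fixAt_mul h1 (fixAt_inv hq)
    obtain ⟨m, hm⟩ := exists_inl_eq_conj h n
    have h3 : (inl n)⁻¹ * h * inl n * h⁻¹ = (inl (n⁻¹ * m) : PermProd P X) := by
      rw [_root_.map_mul, hm, _root_.map_inv]; group
    rw [h3] at h2
    have h4 := h2.eq_one
    rw [inv_mul_eq_one] at h4
    rw [← h4] at hm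
    rw [commute_iff_eq, eq_comm]
    nth_rewrite 1 [hm]
    group
  · intro h1
    rwa [mul_assoc, h1.eq, inv_mul_cancel_left]

/-- The centraliser of a set of elements of the free factor, two of which do not commute, is
determined by finitely many of them. -/
theorem exists_finite_forall_commute (hX : RootStable P X) (hD : FinitelyDetermined P X)
    {M : Set (FreeGroup X)} {s x : FreeGroup X} (hs : s ∈ M) (hx : x ∈ M) (hsx : ¬ Commute s x) :
    ∃ M₀ ⊆ M, M₀.Finite ∧ ∀ d : PermProd P X, (∀ w ∈ M₀, Commute d (inl w)) →
      ∀ w ∈ M, Commute d (inl w) := by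
  have hs1 : s ≠ 1 := by rintro rfl; exact hsx (Commute.one_left _)
  obtain ⟨q, hq⟩ := exists_fixAt_of_commute (P := P) hs1
  have hfix : ∀ d : PermProd P X, Commute d (inl s) → Commute d (inl x) → FixAt q d := by
    intro d hds hdx
    have hd := bdd_of_commute_of_not_commute hX hds hdx hsx
    obtain ⟨m, t, hm, h1⟩ := hq d hds
    have h2 := h1.bdd.mul (hd.pow m).inv ?_
    · rw [mul_inv_cancel_right, ← map_zpow] at h2
      have h3 := eq_one_of_bdd_inl h2
      rw [← map_zpow, h3, map_one, one_mul] at h1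
      exact h1.of_pow hX hm
    · exact (((hds.symm.zpow_left t).pow_right m).mul_left (Commute.refl _)).inv_right
  obtain ⟨Q₀, hQ₀, hf, hQ⟩ := exists_finite_fixAt hD ((fun w => w * q) '' M)
  refine ⟨insert s (insert x ((fun w => w * q) ⁻¹' Q₀)), ?_, ?_, fun d hd w hw => ?_⟩
  · refine Set.insert_subset hs (Set.insert_subset hx fun w hw => ?_)
    obtain ⟨w', hw', he⟩ := hQ₀ hw
    rwa [← mul_right_cancel he]
  · exact ((hf.preimage (mul_left_injective q).injOn).insert _).insert _
  · have h0 : FixAt q d := hfix d (hd s (by simp)) (hd x (by simp))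
    rw [← fixAt_mul_inl_iff h0]
    refine hQ d (fun r hr => ?_) _ ⟨w, hw, rfl⟩
    obtain ⟨w', -, rfl⟩ := hQ₀ hr
    exact (fixAt_mul_inl_iff h0).2 (hd w' (by simp [hr]))

end PermProd

end

section

open Function

section ConjBy

variable {G : Type*} [Group G] {H : Subgroup G} {φ : G →* G}

/-- Every element is sent to a conjugate by an element of `H`. -/
def PointwiseConj (H : Subgroup G) (φ : G →* G) : Prop :=
  ∀ x, ∃ h ∈ H, φ x = h * x * h⁻¹

/-- The endomorphism is conjugation by an element of `H`. -/
def ConjBy (H : Subgroup G) (φ : G →* G) : Prop :=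
  ∃ h ∈ H, ∀ x, φ x = h * x * h⁻¹

theorem conj_comp_apply {K : Type*} [Group K] (b : G) (φ : K →* G) (x : K) :
    ((MulAut.conj b).toMonoidHom.comp φ) x = b * φ x * b⁻¹ := rfl

theorem PointwiseConj.conj (h : PointwiseConj H φ) {b : G} (hb : b ∈ H) :
    PointwiseConj H ((MulAut.conj b).toMonoidHom.comp φ) := by
  intro x
  obtain ⟨a, ha, hx⟩ := h x
  exact ⟨b * a, H.mul_mem hb ha, by simp [hx, mul_assoc]⟩

theorem ConjBy.of_conj {b : G} (hb : b ∈ H)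
    (h : ConjBy H ((MulAut.conj b).toMonoidHom.comp φ)) : ConjBy H φ := by
  obtain ⟨a, ha, hx⟩ := h
  refine ⟨b⁻¹ * a, H.mul_mem (H.inv_mem hb) ha, fun x => ?_⟩
  have h1 : b * φ x * b⁻¹ = a * x * a⁻¹ := by simpa using hx x
  have h2 : φ x = b⁻¹ * (b * φ x * b⁻¹) * b := by group
  rw [h2, h1]; group

theorem ConjBy.of_forall_eq (h : ∀ x, φ x = x) : ConjBy H φ :=
  ⟨1, H.one_mem, by simpa using h⟩

theorem PointwiseConj.mem {N : Subgroup G} (hN : N.Normal) (h : PointwiseConj H φ) {x : G}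
    (hx : x ∈ N) : φ x ∈ N := by
  obtain ⟨a, -, ha⟩ := h x
  rw [ha]; exact hN.conj_mem x hx a

theorem ConjCommute.eq_of_commute (hQ : ConjCommute G) (h : PointwiseConj H φ) {x : G}
    (hx : Commute x (φ x)) : φ x = x := by
  obtain ⟨a, -, ha⟩ := h x
  rw [ha] at hx ⊢
  rw [← (hQ a x hx).eq, mul_inv_cancel_right]

end ConjBy

/-- In every group embedding into `P`, a pointwise conjugation by a normal subgroup is a
conjugation by an element of that subgroup. -/
def PointwiseConjIsConj.{u, v} (P : Type v) [Group P] : Prop :=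
  ∀ (G : Type u) [Group G] (ι : G →* P), Injective ι → ∀ (H : Subgroup G), H.Normal →
    ∀ φ : G →* G, PointwiseConj H φ → ConjBy H φ

/-- Properties of a normal subgroup of `G` acting freely on a tree on which `G` acts. -/
structure IsTreeKernel {G : Type*} [Group G] (N : Subgroup G) : Prop where
  exists_pow : ∀ s ∈ N, s ≠ 1 → ∀ x ∈ N, ∀ y ∈ N, ∃ n : ℕ, ∀ h : G,
    h * (s ^ n * x) * h⁻¹ = s ^ n * y → ∃ k : ℤ, Commute ((s ^ n * y) ^ k * h) s
  eq_one : ∀ n ∈ N, ∀ n' ∈ N, ∀ m ∈ N, ∀ m' ∈ N, ∀ g ∈ N, ∀ d : G, ¬ Commute n n' →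
    ¬ Commute m m' → Commute d n → Commute d n' → Commute (g * d) m → Commute (g * d) m' →
    Commute g d → g = 1
  exists_pow_eq : ∀ y ∈ N, ∀ g ∈ N, g ≠ 1 → Commute y g → ∃ (m : ℕ) (t : ℤ), m ≠ 0 ∧ y ^ m = g ^ t
  exists_finite : ∀ M : Set G, M ⊆ N → ∀ s ∈ M, ∀ x ∈ M, ¬ Commute s x →
    ∃ M₀ ⊆ M, M₀.Finite ∧ ∀ d : G, (∀ w ∈ M₀, Commute d w) → ∀ w ∈ M, Commute d w

namespace IsTreeKernel

variable {G : Type*} [Group G] {N M H : Subgroup G} {φ : G →* G}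

theorem exists_pair [IsMulTorsionFree G] (hN : IsTreeKernel N) (hM : M ≤ N)
    (hne : ∃ s ∈ M, ∃ x ∈ M, ¬ Commute s x) {Y : Set G} (hY : Y.Finite) (hYM : Y ⊆ M) :
    ∃ s ∈ M, ∃ x ∈ M, ¬ Commute s x ∧
      ∀ d : G, Commute d s → Commute d x → ∀ w ∈ Y, Commute d w := by
  induction Y, hY using Set.Finite.induction_on with
  | empty =>
    obtain ⟨s, hs, x, hx, h⟩ := hne
    exact ⟨s, hs, x, hx, h, by simp⟩
  | @insert y Y _ _ ih =>
    have hy : y ∈ M := hYM (Set.mem_insert _ _)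
    obtain ⟨s, hs, x, hx, hsx, hd⟩ := ih ((Set.subset_insert _ _).trans hYM)
    have hs1 : s ≠ 1 := by rintro rfl; exact hsx (Commute.one_left _)
    obtain ⟨n, hn⟩ := hN.exists_pow s (hM hs) hs1 x (hM hx) x (hM hx)
    set g := s ^ n * x with hg
    have hgM : g ∈ M := M.mul_mem (M.pow_mem hs n) hx
    have hxg : x = (s ^ n)⁻¹ * g := by rw [hg]; group
    have hx_of : ∀ d : G, Commute d s → Commute d g → Commute d x := fun d h1 h2 => by
      rw [hxg]; exact (h1.pow_right n).inv_right.mul_right h2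
    have hgs : ¬ Commute s g := fun h => hsx (hx_of s (Commute.refl s) h)
    have hg1 : g ≠ 1 := fun h => hgs (h ▸ Commute.one_right s)
    by_cases hyg : Commute y g
    · refine ⟨s, hs, x, hx, hsx, fun d h1 h2 w hw => ?_⟩
      rcases Set.mem_insert_iff.1 hw with rfl | hw
      · obtain ⟨m, t, hm, he⟩ := hN.exists_pow_eq w (hM hy) g (hM hgM) hg1 hyg
        refine (Commute.of_pow_left hm ?_).symm
        rw [he]
        exact (((h1.pow_right n).mul_right h2).zpow_right t).symm
      · exact hd d h1 h2 w hw
    · refine ⟨g, hgM, y, hy, fun h => hyg h.symm, fun d h1 h2 w hw => ?_⟩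
      rcases Set.mem_insert_iff.1 hw with rfl | hw
      · exact h2
      obtain ⟨k, hk⟩ := hn d (by rw [h1.eq, mul_inv_cancel_right])
      have hkg : Commute (g ^ k * d) g := ((Commute.refl g).zpow_left k).mul_left h1
      have h3 : g ^ (-k) = 1 := hN.eq_one s (hM hs) x (hM hx) g (hM hgM) y (hM hy) _
        (hM (M.zpow_mem hgM _)) (g ^ k * d) hsx (fun h => hyg h.symm) hk (hx_of _ hk hkg)
        (by rw [zpow_neg, inv_mul_cancel_left]; exact h1)
        (by rw [zpow_neg, inv_mul_cancel_left]; exact h2) (hkg.symm.zpow_left _)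
      rw [zpow_neg, inv_eq_one] at h3
      rw [h3, one_mul] at hk
      exact hd d hk (hx_of d hk h1) w hw

theorem exists_generic [IsMulTorsionFree G] (hN : IsTreeKernel N) (hM : M ≤ N)
    (hne : ∃ s ∈ M, ∃ x ∈ M, ¬ Commute s x) :
    ∃ g ∈ M, ∃ s ∈ M, ¬ Commute g s ∧
      ∀ h : G, Commute h g → ∃ k : ℤ, ∀ w ∈ M, Commute (g ^ k * h) w := by
  obtain ⟨s₀, hs₀, x₀, hx₀, h₀⟩ := hne
  obtain ⟨M₀, hM₀, hf, hd⟩ := hN.exists_finite M hM s₀ hs₀ x₀ hx₀ h₀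
  obtain ⟨s, hs, x, hx, hsx, hd'⟩ := hN.exists_pair hM ⟨s₀, hs₀, x₀, hx₀, h₀⟩ hf hM₀
  have hs1 : s ≠ 1 := by rintro rfl; exact hsx (Commute.one_left _)
  obtain ⟨n, hn⟩ := hN.exists_pow s (hM hs) hs1 x (hM hx) x (hM hx)
  set g := s ^ n * x with hg
  have hxg : x = (s ^ n)⁻¹ * g := by rw [hg]; group
  have hx_of : ∀ d : G, Commute d s → Commute d g → Commute d x := fun d h1 h2 => by
    rw [hxg]; exact (h1.pow_right n).inv_right.mul_right h2
  refine ⟨g, M.mul_mem (M.pow_mem hs n) hx, s, hs,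
    fun h => hsx (hx_of s (Commute.refl s) h.symm), fun h hh => ?_⟩
  obtain ⟨k, hk⟩ := hn h (by rw [hh.eq, mul_inv_cancel_right])
  exact ⟨k, hd _ (hd' _ hk (hx_of _ hk (((Commute.refl g).zpow_left k).mul_left hh)))⟩

theorem exists_zpow_conj (hN : IsTreeKernel N) (hM : M ≤ N) (hMn : M.Normal)
    (hφ : PointwiseConj H φ) {g : G} (hg : g ∈ M) (hg1 : g ≠ 1) (hgφ : φ g = g)
    (hgen : ∀ h : G, Commute h g → ∃ k : ℤ, ∀ w ∈ M, Commute (g ^ k * h) w)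
    {x : G} (hx : x ∈ M) : ∃ j : ℤ, φ x = g ^ j * x * (g ^ j)⁻¹ := by
  obtain ⟨n, hn⟩ := hN.exists_pow g (hM hg) hg1 x (hM hx) (φ x) (hM (hφ.mem hMn hx))
  obtain ⟨h, -, hh⟩ := hφ (g ^ n * x)
  rw [map_mul, map_pow, hgφ] at hh
  obtain ⟨k, hk⟩ := hn h hh.symm
  set h' := (g ^ n * φ x) ^ k * h with hh'
  have h1 : h' * (g ^ n * x) * h'⁻¹ = g ^ n * φ x := by
    have : h' * (g ^ n * x) * h'⁻¹ =
        (g ^ n * φ x) ^ k * (h * (g ^ n * x) * h⁻¹) * ((g ^ n * φ x) ^ k)⁻¹ := by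
      rw [hh']; group
    rw [this, ← hh, ((Commute.refl (g ^ n * φ x)).zpow_left k).eq, mul_inv_cancel_right]
  have h2 : φ x = h' * x * h'⁻¹ := by
    have : h' * (g ^ n * x) * h'⁻¹ = g ^ n * (h' * x * h'⁻¹) := by
      rw [← mul_assoc h', (hk.pow_right n).eq]; group
    rw [this] at h1
    exact (mul_left_cancel h1).symm
  obtain ⟨i, hi⟩ := hgen h' hk
  refine ⟨-i, ?_⟩
  have h3 : h' = g ^ (-i) * (g ^ i * h') := by group
  rw [h2, h3]
  generalize g ^ i * h' = c at hi
  have h4 : g ^ (-i) * c * x * (g ^ (-i) * c)⁻¹ = g ^ (-i) * (c * x * c⁻¹) * (g ^ (-i))⁻¹ := by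
    group
  rw [h4, (hi x hx).eq, mul_inv_cancel_right]

end IsTreeKernel

end

section

open Function

section

variable {G : Type*} [Group G] {M H C : Subgroup G} {φ : G →* G}

theorem eq_of_forall_zpow_conj [IsMulTorsionFree G] (hQ : ConjCommute G) {g s : G}
    (hgφ : φ g = g) (hs : s ∈ M)
    (hsφ : φ s = s) (hgs : ¬ Commute g s)
    (hφ : ∀ x ∈ M, ∃ j : ℤ, φ x = g ^ j * x * (g ^ j)⁻¹) {x : G} (hx : x ∈ M) : φ x = x := by
  obtain ⟨j, hj⟩ := hφ x hx
  by_cases hxg : Commute g x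
  · rw [hj, (hxg.zpow_left j).eq, mul_inv_cancel_right]
  obtain ⟨i, hi⟩ := hφ (x * s) (M.mul_mem hx hs)
  have e1 : g ^ i * (x * s) * (g ^ i)⁻¹ = g ^ j * x * (g ^ j)⁻¹ * s := by
    rw [← hi, map_mul, hsφ, hj]
  have e2 : g ^ i * (g ^ j * x * (g ^ j)⁻¹ * s) * (g ^ i)⁻¹ =
      g ^ j * (g ^ j * x * (g ^ j)⁻¹) * (g ^ j)⁻¹ * s := by
    have h1 := congrArg φ e1
    simp only [map_mul, map_inv, map_zpow, hgφ, hsφ, hj] at h1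
    exact h1
  have hc : Commute ((x⁻¹ * g * x) ^ (i - j)) (g ^ j) := by
    have h0 : (x⁻¹ * g * x) ^ (i - j) = x⁻¹ * (g ^ j)⁻¹ * g ^ i * x := by
      have := conj_zpow (a := x⁻¹) (b := g) (i := i - j)
      rw [inv_inv] at this
      rw [this, sub_eq_neg_add, zpow_add, zpow_neg]; group
    have h1 : x⁻¹ * (g ^ j)⁻¹ * g ^ i * x = (g ^ j)⁻¹ * (s * g ^ i * s⁻¹) := by
      have : x⁻¹ * (g ^ j)⁻¹ * g ^ i * x =
          x⁻¹ * (g ^ j)⁻¹ * (g ^ i * (x * s) * (g ^ i)⁻¹) * g ^ i * s⁻¹ := by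
        group
      rw [this, e1]; group
    have h2 : x⁻¹ * (g ^ j)⁻¹ * g ^ i * x =
        (g ^ j)⁻¹ * ((g ^ j)⁻¹ * (s * g ^ i * s⁻¹) * g ^ j) := by
      have : x⁻¹ * (g ^ j)⁻¹ * g ^ i * x = x⁻¹ * (g ^ j)⁻¹ * (g ^ j)⁻¹ *
          (g ^ i * (g ^ j * x * (g ^ j)⁻¹ * s) * (g ^ i)⁻¹) * g ^ i * s⁻¹ * g ^ j := by
        group
      rw [this, e2]; group
    rw [h1] at h2
    have h3 := mul_left_cancel h2
    rw [h0, h1]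
    refine (Commute.refl (g ^ j)).inv_left.mul_left ?_
    rw [commute_iff_eq]
    nth_rewrite 2 [h3]
    group
  have hj0 : j = 0 := by
    by_contra hj0
    have hij : i - j = 0 := by
      by_contra hij
      have h1 := (Commute.of_zpow_left hij hc).symm
      have h2 := (Commute.of_zpow_left hj0 h1)
      have h3 := hQ x⁻¹ g (by rwa [inv_inv])
      exact hxg (by simpa using h3)
    obtain rfl : i = j := by omega
    apply hgs
    refine Commute.of_zpow_left hj0 (k := i) ?_
    have e3 : x * s * (g ^ i)⁻¹ = x * (g ^ i)⁻¹ * s := by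
      apply mul_left_cancel (a := g ^ i)
      simpa only [mul_assoc] using e1
    rw [mul_assoc, mul_assoc] at e3
    have e4 : Commute s (g ^ i)⁻¹ := mul_left_cancel e3
    simpa using e4.symm
  rw [hj, hj0]; simp

theorem eq_of_forall_eq_of_forall_eq (hQ : ConjCommute G) (hM : M.Normal) (hC : C.Normal)
    (hMC : ∀ c, c ∈ C ↔ ∀ w ∈ M, Commute c w) (hφ : PointwiseConj H φ)
    (hφM : ∀ x ∈ M, φ x = x) (hφC : ∀ x ∈ C, φ x = x) (x : G) : φ x = x := by
  have key : ∀ m, φ m = m → φ (x * m * x⁻¹) = x * m * x⁻¹ → Commute (x⁻¹ * φ x) m := by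
    intro m h1 h2
    rw [map_mul, map_mul, map_inv, h1] at h2
    have h3 : x⁻¹ * φ x * m = x⁻¹ * (φ x * m * (φ x)⁻¹) * φ x := by group
    rw [commute_iff_eq, h3, h2]
    group
  have hz : x⁻¹ * φ x ∈ C := (hMC _).2 fun m hm =>
    key m (hφM m hm) (hφM _ (hM.conj_mem m hm x))
  have hzC : ∀ c ∈ C, Commute (x⁻¹ * φ x) c := fun c hc =>
    key c (hφC c hc) (hφC _ (hC.conj_mem c hc x))
  have hzx : Commute (x⁻¹ * φ x) x := hQ x _ (hzC _ (hC.conj_mem _ hz x))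
  refine hQ.eq_of_commute hφ ?_
  have h1 : φ x = x * (x⁻¹ * φ x) := by group
  rw [h1]
  exact (Commute.refl x).mul_right hzx.symm

theorem exists_eq_conj_of_commute (hHM : M ≤ H) (hM : M.Normal) (hC : C.Normal)
    (hMC : ∀ c, c ∈ C ↔ ∀ w ∈ M, Commute c w) (hMC1 : ∀ x ∈ M, x ∈ C → x = 1)
    (hφ : PointwiseConj H φ) {g : G} (hg : g ∈ M) (hgφ : φ g = g)
    (hgen : ∀ h : G, Commute h g → ∃ k : ℤ, ∀ w ∈ M, Commute (g ^ k * h) w)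
    {c : G} (hc : c ∈ C) : ∃ a ∈ H, a ∈ C ∧ φ c = a * c * a⁻¹ := by
  obtain ⟨h, hH, hh⟩ := hφ (g * c)
  rw [map_mul, hgφ] at hh
  have h1 : g⁻¹ * (h * g * h⁻¹) = φ c * (h * c * h⁻¹)⁻¹ := by
    have : φ c = g⁻¹ * (h * (g * c) * h⁻¹) := by rw [← hh]; group
    rw [this]; group
  have h2 : g⁻¹ * (h * g * h⁻¹) = 1 := by
    refine hMC1 _ (M.mul_mem (M.inv_mem hg) (hM.conj_mem g hg h)) ?_
    rw [h1]
    exact C.mul_mem (hφ.mem hC hc) (C.inv_mem (hC.conj_mem c hc h))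
  have h3 : Commute h g := by
    rw [inv_mul_eq_one] at h2
    rw [commute_iff_eq]
    nth_rewrite 2 [h2]
    group
  have h4 : φ c = h * c * h⁻¹ := by
    rw [h2] at h1
    exact mul_inv_eq_one.1 h1.symm
  obtain ⟨k, hk⟩ := hgen h h3
  have hkC : g ^ k * h ∈ C := (hMC _).2 hk
  refine ⟨g ^ k * h, H.mul_mem (H.zpow_mem (hHM hg) k) hH, hkC, ?_⟩
  have h5 : Commute (h * c * h⁻¹) g := (hMC _).1 (hC.conj_mem c hc h) g hg
  have h6 : g ^ k * h * c * (g ^ k * h)⁻¹ = g ^ k * (h * c * h⁻¹) * (g ^ k)⁻¹ := by group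
  rw [h4, h6, ← (h5.zpow_right k).eq, mul_inv_cancel_right]

end

end

section

open Function

universe u v

section

variable {G : Type u} [Group G] {P : Type v} [Group P] {r : G →* P} {H : Subgroup G} {φ : G →* G}

theorem conjBy_of_forall_commute (hQ : ConjCommute G) (hP : PointwiseConjIsConj.{u} P)
    (hH : H.Normal) (hφ : PointwiseConj H φ)
    (hab : ∀ x ∈ H ⊓ r.ker, ∀ y ∈ H ⊓ r.ker, Commute x y) : ConjBy H φ := by
  have hle : r.ker ≤ r.ker.comap φ := fun x hx => hφ.mem inferInstance hx
  obtain ⟨b', hb', hb⟩ := hP (G ⧸ r.ker) (QuotientGroup.kerLift r)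
    (QuotientGroup.kerLift_injective r) (H.map (QuotientGroup.mk' r.ker))
    (hH.map _ (QuotientGroup.mk'_surjective _)) (QuotientGroup.map r.ker r.ker φ hle) (by
      intro x
      induction x using QuotientGroup.induction_on with
      | H x =>
        obtain ⟨h, hh, hx⟩ := hφ x
        exact ⟨h, ⟨h, hh, rfl⟩, by rw [QuotientGroup.map_mk, hx]; rfl⟩)
  obtain ⟨b, hbH, rfl⟩ := hb'
  have hbH' := H.inv_mem hbH
  refine ConjBy.of_conj hbH' (ConjBy.of_forall_eq fun x => ?_)
  have hφ' := hφ.conj hbH'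
  set ψ := (MulAut.conj b⁻¹).toMonoidHom.comp φ with hψ
  have hmem : ∀ x, ψ x * x⁻¹ ∈ H ⊓ r.ker := by
    intro x
    constructor
    · obtain ⟨h, hh, hx⟩ := hφ' x
      have : h * x * h⁻¹ * x⁻¹ = h * (x * h⁻¹ * x⁻¹) := by group
      rw [hx, this]
      exact H.mul_mem hh (hH.conj_mem _ (H.inv_mem hh) x)
    · have h1 := hb (x : G ⧸ r.ker)
      have h2 := congrArg (QuotientGroup.kerLift r) h1
      rw [map_mul, map_mul, map_inv] at h2
      have h3 : r (φ x) = r b * r x * (r b)⁻¹ := h2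
      change r (ψ x * x⁻¹) = 1
      rw [hψ, conj_comp_apply]
      simp only [map_mul, map_inv, h3]
      group
  have hM : (H ⊓ r.ker).Normal := Subgroup.normal_inf_normal _ _
  have h1 : Commute (ψ x * x⁻¹) x := hQ x _ (hab _ (hmem x) _ (hM.conj_mem _ (hmem x) x))
  refine hQ.eq_of_commute hφ' ?_
  have h2 : ψ x = ψ x * x⁻¹ * x := by group
  rw [h2]
  exact h1.symm.mul_right (Commute.refl x)

theorem conjBy_of_not_commute [IsMulTorsionFree G] (hQ : ConjCommute G)
    (hP : PointwiseConjIsConj.{u} P) (hN : IsTreeKernel r.ker)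
    (hH : H.Normal) (hφ : PointwiseConj H φ)
    (hab : ∃ x ∈ H ⊓ r.ker, ∃ y ∈ H ⊓ r.ker, ¬ Commute x y) : ConjBy H φ := by
  have hM : (H ⊓ r.ker).Normal := Subgroup.normal_inf_normal _ _
  have hMN : H ⊓ r.ker ≤ r.ker := inf_le_right
  have hHM : H ⊓ r.ker ≤ H := inf_le_left
  obtain ⟨g, hg, s, hs, hgs, hgen⟩ := hN.exists_generic hMN hab
  generalize hMdef : H ⊓ r.ker = M at *
  have hg1 : g ≠ 1 := by rintro rfl; exact hgs (Commute.one_left _)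
  -- normalise so that `g` is fixed
  obtain ⟨h, hhH, hh⟩ := hφ g
  have hhH' := H.inv_mem hhH
  refine ConjBy.of_conj hhH' ?_
  replace hφ := hφ.conj hhH'
  have hgφ : (MulAut.conj h⁻¹).toMonoidHom.comp φ g = g := by
    rw [conj_comp_apply, hh]; group
  generalize (MulAut.conj h⁻¹).toMonoidHom.comp φ = φ at *
  -- normalise so that `s` is fixed as well
  obtain ⟨j, hj⟩ := hN.exists_zpow_conj hMN hM hφ hg hg1 hgφ hgen hs
  have hjH : (g ^ j)⁻¹ ∈ H := H.inv_mem (H.zpow_mem (hHM hg) j)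
  refine ConjBy.of_conj hjH ?_
  replace hφ := hφ.conj hjH
  have hsφ : (MulAut.conj (g ^ j)⁻¹).toMonoidHom.comp φ s = s := by
    rw [conj_comp_apply, hj]; group
  replace hgφ : (MulAut.conj (g ^ j)⁻¹).toMonoidHom.comp φ g = g := by
    rw [conj_comp_apply, hgφ]; group
  generalize (MulAut.conj (g ^ j)⁻¹).toMonoidHom.comp φ = φ at *
  have hφM : ∀ x ∈ M, φ x = x := fun x hx => eq_of_forall_zpow_conj hQ hgφ hs hsφ hgs
    (fun x hx => hN.exists_zpow_conj hMN hM hφ hg hg1 hgφ hgen hx) hx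
  -- the centraliser of `M` embeds into `P`
  have hC : (Subgroup.centralizer (M : Set G)).Normal := inferInstance
  have hMC : ∀ c, c ∈ Subgroup.centralizer (M : Set G) ↔ ∀ w ∈ M, Commute c w := fun c => by
    rw [Subgroup.mem_centralizer_iff]
    exact forall₂_congr fun _ _ => eq_comm
  generalize Subgroup.centralizer (M : Set G) = C at *
  have hNC : ∀ x ∈ r.ker, x ∈ C → x = 1 := fun x hx hxC =>
    hN.eq_one g (hMN hg) s (hMN hs) g (hMN hg) s (hMN hs) x hx 1 hgs hgs (Commute.one_left _)
      (Commute.one_left _) (by rw [mul_one]; exact (hMC x).1 hxC g hg)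
      (by rw [mul_one]; exact (hMC x).1 hxC s hs) (Commute.one_right _)
  obtain ⟨κ, hκ, hκC⟩ := hP C (r.comp C.subtype) (by
      rw [injective_iff_map_eq_one]
      exact fun a ha => Subtype.ext (hNC a ha a.2))
    (H.subgroupOf C) (hH.subgroupOf C)
    ((φ.comp C.subtype).codRestrict C fun c => hφ.mem hC c.2) (by
      intro c
      obtain ⟨a, ha, haC, hac⟩ := exists_eq_conj_of_commute hHM hM hC hMC
        (fun x hx => hNC x (hMN hx)) hφ hg hgφ hgen c.2
      exact ⟨⟨a, haC⟩, ha, Subtype.ext hac⟩)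
  have hκH : (κ : G)⁻¹ ∈ H := H.inv_mem hκ
  refine ConjBy.of_conj hκH (ConjBy.of_forall_eq ?_)
  refine eq_of_forall_eq_of_forall_eq hQ hM hC hMC (hφ.conj hκH) (fun x hx => ?_) fun x hx => ?_
  · have h1 : Commute (κ : G) x := (hMC _).1 κ.2 x hx
    rw [conj_comp_apply, hφM x hx, h1.inv_left.eq, mul_inv_cancel_right]
  · have h1 : φ x = κ * x * (κ : G)⁻¹ := congrArg Subtype.val (hκC ⟨x, hx⟩)
    rw [conj_comp_apply, h1]; group

end

end

section

open FreeGroup hiding map_one map_mul map_inv map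
open SemidirectProduct hiding map
open Function

universe u

theorem ConjCommute.of_injective {G P : Type*} [Group G] [Group P] (hP : ConjCommute P)
    (ι : G →* P) (hι : Injective ι) : ConjCommute G := fun x z h =>
  Commute.of_map hι (hP (ι x) (ι z) (by simpa using h.map ι))

theorem IsMulTorsionFree.of_injective {G P : Type*} [Group G] [Group P] [IsMulTorsionFree P]
    (ι : G →* P) (hι : Injective ι) : IsMulTorsionFree G :=
  ⟨fun k hk x y h => hι (pow_left_injective hk (by
    simpa using congrArg ι h))⟩

theorem PointwiseConjIsConj.of_injective {A P : Type*} [Group A] [Group P]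
    (hP : PointwiseConjIsConj.{u} P) (j : A →* P) (hj : Injective j) :
    PointwiseConjIsConj.{u} A := fun G _ ι hι =>
  hP G (j.comp ι) (hj.comp hι)

namespace PermProd

variable {P X : Type*} [Group P] [MulAction P X]

theorem isTreeKernel (hX : RootStable P X) (hD : FinitelyDetermined P X) {G : Type*} [Group G]
    (ι : G →* PermProd P X) (hι : Injective ι) : IsTreeKernel (rightHom.comp ι).ker := by
  have hmem : ∀ x ∈ (rightHom.comp ι).ker, ι x = inl (ι x).left := fun x hx =>
    eq_inl_of_right_eq_one hx
  have hcomm : ∀ x y, Commute (ι x) (ι y) ↔ Commute x y := fun x y => commute_map_iff hι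
  have hcl : ∀ x ∈ (rightHom.comp ι).ker, ∀ y ∈ (rightHom.comp ι).ker,
      (Commute (ι x).left (ι y).left ↔ Commute x y) := fun x hx y hy => by
    rw [← hcomm, hmem x hx, hmem y hy, commute_inl_iff]; rfl
  have hone : ∀ x ∈ (rightHom.comp ι).ker, (ι x).left = 1 → x = 1 := fun x hx h => by
    apply hι
    rw [hmem x hx, h, map_one, map_one]
  have hcr : ∀ d, ∀ y ∈ (rightHom.comp ι).ker,
      (Commute (ι d) (inl (ι y).left) ↔ Commute d y) := fun d y hy => by
    rw [← hmem y hy, hcomm]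
  refine ⟨?_, ?_, ?_, ?_⟩
  · intro s hs hs1 x hx y hy
    obtain ⟨n, hn⟩ := exists_pow_forall_commute (P := P) (fun h => hs1 (hone s hs h))
      (ι x).left (ι y).left
    refine ⟨n, fun h hh => ?_⟩
    have e : ∀ z ∈ (rightHom.comp ι).ker,
        (inl ((ι s).left ^ n * (ι z).left) : PermProd P X) = ι (s ^ n * z) := fun z hz => by
      rw [map_mul ι, map_pow ι, hmem s hs, hmem z hz, map_mul, map_pow]; rfl
    obtain ⟨k, hk⟩ := hn (ι h) (by rw [e x hx, e y hy, ← hh]; simp)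
    refine ⟨k, ?_⟩
    rw [e y hy, ← hmem s hs, ← map_zpow, ← map_mul, hcomm] at hk
    exact hk
  · intro n hn n' hn' m hm m' hm' g hg d hnn hmm h1 h2 h3 h4 hgd
    rw [← hcl _ hn _ hn'] at hnn
    rw [← hcl _ hm _ hm'] at hmm
    rw [← hcr _ _ hn] at h1
    rw [← hcr _ _ hn'] at h2
    rw [← hcr _ _ hm] at h3
    rw [← hcr _ _ hm'] at h4
    have b1 := bdd_of_commute_of_not_commute hX h1 h2 hnn
    have b2 := bdd_of_commute_of_not_commute hX h3 h4 hmm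
    have b3 := b2.mul b1.inv
      (((hcomm _ _).2 (hgd.mul_left (Commute.refl d))).inv_right)
    rw [map_mul, mul_inv_cancel_right, hmem g hg] at b3
    exact hone g hg (eq_one_of_bdd_inl b3)
  · intro y hy g hg hg1 hc
    obtain ⟨m, t, hm, he⟩ := FreeGroup.exists_pow_eq_zpow_of_commute ((hcl _ hy _ hg).2 hc)
      (fun h => hg1 (hone g hg h))
    refine ⟨m, t, hm, hι ?_⟩
    rw [map_pow, map_zpow, hmem y hy, hmem g hg, ← map_pow, ← map_zpow, he]
  · intro M hM s hs x hx hsx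
    obtain ⟨M₀, hM₀, hf, hd⟩ := exists_finite_forall_commute hX hD
      (M := (fun w => (ι w).left) '' M) ⟨s, hs, rfl⟩ ⟨x, hx, rfl⟩
      (by rwa [hcl _ (hM hs) _ (hM hx)])
    obtain ⟨M₁, hM₁, hf', hM₁'⟩ : ∃ M₁ ⊆ M, M₁.Finite ∧ M₀ ⊆ (fun w => (ι w).left) '' M₁ := by
      have hch : ∀ w ∈ M₀, ∃ v ∈ M, (ι v).left = w := fun w hw => hM₀ hw
      choose! c hc hc' using hch
      refine ⟨c '' M₀, Set.image_subset_iff.2 hc, hf.image c, fun w hw => ?_⟩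
      exact ⟨c w, ⟨w, hw, rfl⟩, hc' w hw⟩
    refine ⟨M₁, hM₁, hf', fun d hdM w hw => ?_⟩
    rw [← hcr _ _ (hM hw)]
    refine hd _ (fun v hv => ?_) _ ⟨w, hw, rfl⟩
    obtain ⟨u, hu, rfl⟩ := hM₁' hv
    exact (hcr _ _ (hM (hM₁ hu))).2 (hdM u hu)

theorem pointwiseConjIsConj [IsMulTorsionFree P] (hX : RootStable P X)
    (hD : FinitelyDetermined P X) (hQ : ConjCommute P) (hP : PointwiseConjIsConj.{u} P) :
    PointwiseConjIsConj.{u} (PermProd P X) := by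
  intro G _ ι hι H hH φ hφ
  have := isMulTorsionFree hX
  have := IsMulTorsionFree.of_injective ι hι
  have hQ' := (conjCommute hX hQ).of_injective ι hι
  by_cases hab : ∀ x ∈ H ⊓ (rightHom.comp ι).ker, ∀ y ∈ H ⊓ (rightHom.comp ι).ker, Commute x y
  · exact conjBy_of_forall_commute hQ' hP hH hφ hab
  · push Not at hab
    exact conjBy_of_not_commute hQ' hP (isTreeKernel hX hD ι hι) hH hφ hab

end PermProd

end

section

open FreeGroup hiding map_one map_mul map_inv map of lift
open SemidirectProduct hiding map lift
open Function

theorem QuotientGroup.smul_mk_eq_iff {G : Type*} [Group G] {A : Subgroup G} {p w : G} :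
    p • (w : G ⧸ A) = w ↔ w⁻¹ * p * w ∈ A := by
  rw [eq_comm, mul_assoc]
  exact QuotientGroup.eq

namespace RAAG

variable {V : Type*} {Γ : SimpleGraph V} {G : Type*} [Group G]

/-- The homomorphism defined by a family of elements, adjacent ones of which commute. -/
def lift (f : V → G) (hf : ∀ u v, Γ.Adj u v → Commute (f u) (f v)) : RAAG Γ →* G :=
  PresentedGroup.toGroup (f := f) (by
    rintro r ⟨u, v, huv, rfl⟩
    simp only [_root_.map_mul, _root_.map_inv, FreeGroup.lift_apply_of]
    rw [(hf u v huv).eq]; group)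

/-- The standard generators. -/
def of (Γ : SimpleGraph V) (v : V) : RAAG Γ := PresentedGroup.of v

@[simp]
theorem lift_of (f : V → G) (hf : ∀ u v, Γ.Adj u v → Commute (f u) (f v)) (v : V) :
    lift f hf (of Γ v) = f v := PresentedGroup.toGroup.of _

theorem hom_ext {f g : RAAG Γ →* G} (h : ∀ v, f (of Γ v) = g (of Γ v)) : f = g :=
  PresentedGroup.ext h

theorem commute_of {u v : V} (h : Γ.Adj u v) : Commute (of Γ u) (of Γ v) := by
  have : of Γ u * of Γ v * (of Γ u)⁻¹ * (of Γ v)⁻¹ = 1 :=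
    PresentedGroup.one_of_mem (rels := raagRels Γ) ⟨u, v, h, rfl⟩
  rw [commute_iff_eq, ← mul_inv_eq_one, ← this]; group

open Classical in
/-- The retraction killing the generators outside of `T`. -/
noncomputable def retract (Γ : SimpleGraph V) (T : Set V) : RAAG Γ →* RAAG Γ :=
  lift (fun v => if v ∈ T then of Γ v else 1) fun u v h => by
    split_ifs <;> simp [commute_of h]

theorem retract_of_mem {T : Set V} {v : V} (h : v ∈ T) : retract Γ T (of Γ v) = of Γ v := by
  simp [retract, h]

theorem retract_of_notMem {T : Set V} {v : V} (h : v ∉ T) : retract Γ T (of Γ v) = 1 := by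
  simp [retract, h]

theorem retract_retract (S T : Set V) (a : RAAG Γ) :
    retract Γ S (retract Γ T a) = retract Γ (S ∩ T) a := by
  refine DFunLike.congr_fun (hom_ext (f := (retract Γ S).comp (retract Γ T)) fun v => ?_) a
  rw [MonoidHom.comp_apply]
  by_cases hT : v ∈ T
  · by_cases hS : v ∈ S
    · rw [retract_of_mem hT, retract_of_mem hS, retract_of_mem (show v ∈ S ∩ T from ⟨hS, hT⟩)]
    · rw [retract_of_mem hT, retract_of_notMem hS, retract_of_notMem fun h => hS h.1]
  · rw [retract_of_notMem hT, _root_.map_one, retract_of_notMem fun h => hT h.2]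

theorem retract_univ (a : RAAG Γ) : retract Γ Set.univ a = a :=
  DFunLike.congr_fun (hom_ext (g := MonoidHom.id _) fun v => retract_of_mem (Set.mem_univ v)) a

/-- The subgroup generated by the vertices in `T`. -/
noncomputable def parabolic (Γ : SimpleGraph V) (T : Set V) : Subgroup (RAAG Γ) :=
  (retract Γ T).eqLocus (MonoidHom.id _)

theorem mem_parabolic {T : Set V} {a : RAAG Γ} : a ∈ parabolic Γ T ↔ retract Γ T a = a := Iff.rfl

theorem of_mem_parabolic {T : Set V} {v : V} (h : v ∈ T) : of Γ v ∈ parabolic Γ T :=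
  retract_of_mem h

theorem parabolic_mono {S T : Set V} (h : S ⊆ T) : parabolic Γ S ≤ parabolic Γ T := fun a ha => by
  rw [mem_parabolic] at ha ⊢
  rw [← ha, retract_retract, Set.inter_eq_right.2 h]

theorem parabolic_inter (S T : Set V) :
    parabolic Γ (S ∩ T) = parabolic Γ S ⊓ parabolic Γ T := by
  refine le_antisymm (le_inf (parabolic_mono Set.inter_subset_left)
    (parabolic_mono Set.inter_subset_right)) fun a ha => ?_
  have h1 := mem_parabolic.1 ha.1
  rw [← mem_parabolic.1 ha.2, retract_retract] at h1
  rw [mem_parabolic, h1, mem_parabolic.1 ha.2]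

theorem parabolic_univ : parabolic Γ Set.univ = ⊤ := by
  ext a; simp [mem_parabolic, retract_univ]

section Vertex

variable (v : V)

/-- The homomorphism induced by the inclusion of a set of vertices. -/
def incl (Γ : SimpleGraph V) (T : Set V) : RAAG (Γ.induce T) →* RAAG Γ :=
  lift (fun w => of Γ w) fun _ _ h => commute_of h

@[simp]
theorem incl_of (T : Set V) (w : T) : incl Γ T (of _ w) = of Γ w := lift_of _ _ _

/-- The neighbours of `v`. -/
def link (Γ : SimpleGraph V) (v : V) : Set ({v}ᶜ : Set V) := {w | Γ.Adj v w}

/-- The cosets permuted in the splitting of a right-angled Artin group at `v`. -/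
abbrev Cosets (Γ : SimpleGraph V) (v : V) : Type _ :=
  RAAG (Γ.induce {v}ᶜ) ⧸ parabolic (Γ.induce {v}ᶜ) (link Γ v)

open Classical in
/-- The splitting of a right-angled Artin group at a vertex. -/
noncomputable def split (Γ : SimpleGraph V) (v : V) :
    RAAG Γ →* PermProd (RAAG (Γ.induce {v}ᶜ)) (Cosets Γ v) :=
  lift (fun w => if h : w = v then inl (FreeGroup.of ((1 : RAAG (Γ.induce {v}ᶜ)) : Cosets Γ v))
    else inr (of (Γ.induce {v}ᶜ) ⟨w, h⟩)) (by
    have key : ∀ w (h : w ≠ v), Γ.Adj v w →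
        Commute (inl (FreeGroup.of ((1 : RAAG (Γ.induce {v}ᶜ)) : Cosets Γ v)))
          (inr (of (Γ.induce {v}ᶜ) ⟨w, h⟩) :
            PermProd (RAAG (Γ.induce {v}ᶜ)) (Cosets Γ v)) := by
      intro w h hw
      have h1 : of (Γ.induce {v}ᶜ) ⟨w, h⟩ • ((1 : RAAG (Γ.induce {v}ᶜ)) : Cosets Γ v) =
          ((1 : RAAG (Γ.induce {v}ᶜ)) : Cosets Γ v) := by
        rw [QuotientGroup.smul_mk_eq_iff, inv_one, one_mul, mul_one]
        exact of_mem_parabolic (Γ := Γ.induce {v}ᶜ) (T := link Γ v) hw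
      have h2 := inl_aut (φ := permAut (RAAG (Γ.induce {v}ᶜ)) (Cosets Γ v))
        (of (Γ.induce {v}ᶜ) ⟨w, h⟩) (FreeGroup.of ((1 : RAAG (Γ.induce {v}ᶜ)) : Cosets Γ v))
      rw [permAut_of, h1, map_inv] at h2
      exact eq_mul_inv_iff_mul_eq.1 h2
    intro u w huw
    by_cases hu : u = v
    · subst hu
      have hw : w ≠ u := huw.ne'
      simpa [hw] using key w hw huw
    · by_cases hw : w = v
      · subst hw
        simpa [hu] using (key u hu huw.symm).symm
      · simp only [hu, hw, dite_false]
        exact (commute_of (Γ := Γ.induce {v}ᶜ) (u := ⟨u, hu⟩) (v := ⟨w, hw⟩) huw).map inr)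

theorem split_of_self : split Γ v (of Γ v) =
    inl (FreeGroup.of ((1 : RAAG (Γ.induce {v}ᶜ)) : Cosets Γ v)) := by
  simp [split]

theorem split_of_ne {w : V} (h : w ≠ v) : split Γ v (of Γ w) =
    inr (of (Γ.induce {v}ᶜ) ⟨w, h⟩) := by
  simp [split, h]

end Vertex

end RAAG

end

section

open FreeGroup hiding map_one map_mul map_inv map of lift
open SemidirectProduct hiding map lift
open Function

namespace RAAG

variable {V : Type*} {Γ : SimpleGraph V} {v : V}

theorem commute_of_incl {a : RAAG (Γ.induce {v}ᶜ)}
    (ha : a ∈ parabolic (Γ.induce {v}ᶜ) (link Γ v)) : Commute (of Γ v) (incl Γ {v}ᶜ a) := by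
  have h := DFunLike.congr_fun (hom_ext
    (f := (MulAut.conj (of Γ v)).toMonoidHom.comp ((incl Γ {v}ᶜ).comp (retract _ (link Γ v))))
    (g := (incl Γ {v}ᶜ).comp (retract _ (link Γ v))) fun w => by
      rw [conj_comp_apply, MonoidHom.comp_apply]
      by_cases hw : w ∈ link Γ v
      · rw [retract_of_mem hw, incl_of, (commute_of (show Γ.Adj v w from hw)).eq,
          mul_inv_cancel_right]
      · rw [retract_of_notMem hw, map_one, mul_one, mul_inv_cancel]) a
  rw [conj_comp_apply, MonoidHom.comp_apply, mem_parabolic.1 ha] at h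
  exact mul_inv_eq_iff_eq_mul.1 h

/-- The conjugate of `v` by a representative of the coset. -/
noncomputable def conjVertex (Γ : SimpleGraph V) (v : V) : Cosets Γ v → RAAG Γ :=
  Quotient.lift (s := QuotientGroup.leftRel _)
    (fun a => incl Γ {v}ᶜ a * of Γ v * (incl Γ {v}ᶜ a)⁻¹) fun a b h => by
      have h1 := commute_of_incl (QuotientGroup.leftRel_apply.1 h)
      have h2 : incl Γ {v}ᶜ b = incl Γ {v}ᶜ a * incl Γ {v}ᶜ (a⁻¹ * b) := by
        rw [← map_mul, mul_inv_cancel_left]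
      have h3 : incl Γ {v}ᶜ a * incl Γ {v}ᶜ (a⁻¹ * b) * of Γ v *
          (incl Γ {v}ᶜ a * incl Γ {v}ᶜ (a⁻¹ * b))⁻¹ = incl Γ {v}ᶜ a *
            (incl Γ {v}ᶜ (a⁻¹ * b) * of Γ v * (incl Γ {v}ᶜ (a⁻¹ * b))⁻¹) *
              (incl Γ {v}ᶜ a)⁻¹ := by group
      simp only [h2]
      rw [h3, ← h1.eq, mul_inv_cancel_right]

theorem conjVertex_mk (a : RAAG (Γ.induce {v}ᶜ)) :
    conjVertex Γ v (a : Cosets Γ v) = incl Γ {v}ᶜ a * of Γ v * (incl Γ {v}ᶜ a)⁻¹ := rfl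

/-- The inverse of the splitting. -/
noncomputable def unsplit (Γ : SimpleGraph V) (v : V) :
    PermProd (RAAG (Γ.induce {v}ᶜ)) (Cosets Γ v) →* RAAG Γ :=
  SemidirectProduct.lift (FreeGroup.lift (conjVertex Γ v)) (incl Γ {v}ᶜ) fun a => by
    refine FreeGroup.ext_hom _ _ fun x => ?_
    induction x using QuotientGroup.induction_on with
    | H b =>
      have h : a • (b : Cosets Γ v) = ((a * b : RAAG (Γ.induce {v}ᶜ)) : Cosets Γ v) := rfl
      simp only [MonoidHom.comp_apply, MulEquiv.coe_toMonoidHom, permAut_of, h,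
        FreeGroup.lift_apply_of, conjVertex_mk, MulAut.conj_apply, map_mul]
      group

theorem unsplit_split (a : RAAG Γ) : unsplit Γ v (split Γ v a) = a := by
  refine DFunLike.congr_fun (hom_ext (f := (unsplit Γ v).comp (split Γ v))
    (g := MonoidHom.id _) fun w => ?_) a
  rw [MonoidHom.comp_apply]
  by_cases h : w = v
  · subst h
    rw [split_of_self, unsplit, lift_inl, FreeGroup.lift_apply_of, conjVertex_mk]
    simp
  · rw [split_of_ne v h, unsplit, lift_inr]
    simp

theorem split_injective : Injective (split Γ v) :=
  LeftInverse.injective (g := unsplit Γ v) unsplit_split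

theorem split_incl (a : RAAG (Γ.induce {v}ᶜ)) : split Γ v (incl Γ {v}ᶜ a) = inr a := by
  refine DFunLike.congr_fun (hom_ext (f := (split Γ v).comp (incl Γ {v}ᶜ)) (g := inr)
    fun w => ?_) a
  rw [MonoidHom.comp_apply, incl_of, split_of_ne v w.2]

theorem incl_right_split (a : RAAG Γ) : incl Γ {v}ᶜ (split Γ v a).right = retract Γ {v}ᶜ a := by
  refine DFunLike.congr_fun (hom_ext
    (f := (incl Γ {v}ᶜ).comp (rightHom.comp (split Γ v))) fun w => ?_) a
  rw [MonoidHom.comp_apply, MonoidHom.comp_apply]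
  by_cases h : w = v
  · subst h
    rw [split_of_self, rightHom_inl, map_one, retract_of_notMem (by simp)]
  · rw [split_of_ne v h, rightHom_inr, incl_of, retract_of_mem h]

theorem left_split_eq_one_iff {a : RAAG Γ} : (split Γ v a).left = 1 ↔ a ∈ parabolic Γ {v}ᶜ := by
  rw [mem_parabolic, ← incl_right_split]
  constructor
  · intro h
    apply split_injective (v := v)
    rw [split_incl, ← PermProd.eq_inr_of_left_eq_one h]
  · intro h
    rw [← h, split_incl, left_inr]

theorem rootStable [IsMulTorsionFree (RAAG Γ)] (T : Set V) :
    RootStable (RAAG Γ) (RAAG Γ ⧸ parabolic Γ T) := by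
  intro p x k hk
  induction x using QuotientGroup.induction_on with
  | H w =>
    rw [QuotientGroup.smul_mk_eq_iff, QuotientGroup.smul_mk_eq_iff, mem_parabolic, mem_parabolic]
    intro h
    apply pow_left_injective hk
    have h1 : (w⁻¹ * p * w) ^ k = w⁻¹ * p ^ k * w := by
      simpa using conj_pow (a := w⁻¹) (b := p) (i := k)
    change _ ^ k = _ ^ k
    rw [← map_pow, h1, h]

end RAAG

end

section

open FreeGroup hiding map_one map_mul map_inv map of lift
open SemidirectProduct hiding map lift
open Function

universe u w

/-- The intersection of arbitrarily many conjugates of `A` with common conjugators is determined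
by finitely many of them. -/
def FinitelyDeterminedConj {G : Type*} [Group G] (A : Subgroup G) : Prop :=
  ∀ Y : Set G, ∃ Y₀ ⊆ Y, Y₀.Finite ∧
    ∀ p : G, (∀ w ∈ Y₀, w⁻¹ * p * w ∈ A) → ∀ w ∈ Y, w⁻¹ * p * w ∈ A

theorem FinitelyDeterminedConj.finitelyDetermined {G : Type*} [Group G] {A : Subgroup G}
    (h : FinitelyDeterminedConj A) : FinitelyDetermined G (G ⧸ A) := by
  intro Y
  obtain ⟨Y₀, hY, hf, hd⟩ := h ((fun w : G => (w : G ⧸ A)) ⁻¹' Y)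
  refine ⟨(fun w : G => (w : G ⧸ A)) '' Y₀, Set.image_subset_iff.2 hY, hf.image _,
    fun p hp x hx => ?_⟩
  induction x using QuotientGroup.induction_on with
  | H a =>
    rw [QuotientGroup.smul_mk_eq_iff]
    exact hd p (fun b hb => QuotientGroup.smul_mk_eq_iff.1 (hp _ ⟨b, hb, rfl⟩)) a hx

theorem FinitelyDeterminedConj.inf {G : Type*} [Group G] {A B : Subgroup G}
    (hA : FinitelyDeterminedConj A) (hB : FinitelyDeterminedConj B) :
    FinitelyDeterminedConj (A ⊓ B) := by
  intro Y
  obtain ⟨Y₁, h1, f1, d1⟩ := hA Y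
  obtain ⟨Y₂, h2, f2, d2⟩ := hB Y
  exact ⟨Y₁ ∪ Y₂, Set.union_subset h1 h2, f1.union f2, fun p hp x hx =>
    ⟨d1 p (fun y hy => (hp y (Or.inl hy)).1) x hx, d2 p (fun y hy => (hp y (Or.inr hy)).2) x hx⟩⟩

theorem PointwiseConjIsConj.of_subsingleton {P : Type*} [Group P] [Subsingleton P] :
    PointwiseConjIsConj.{u} P := fun _ _ _ hι _ _ _ _ =>
  ConjBy.of_forall_eq fun _ => hι (Subsingleton.elim _ _)

namespace RAAG

theorem finitelyDeterminedConj_compl_singleton {V : Type*} {Γ : SimpleGraph V} {v : V}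
    (h : FinitelyDetermined (RAAG (Γ.induce {v}ᶜ)) (Cosets Γ v)) :
    FinitelyDeterminedConj (parabolic Γ {v}ᶜ) := by
  have key : ∀ p w : RAAG Γ, w⁻¹ * p * w ∈ parabolic Γ {v}ᶜ ↔
      PermProd.FixAt (split Γ v w).left (split Γ v p) := by
    intro p w
    rw [← left_split_eq_one_iff, map_mul, map_mul, map_inv, PermProd.FixAt]
    generalize split Γ v p = h
    nth_rewrite 1 2 [← inl_left_mul_inr_right (split Γ v w)]
    generalize (split Γ v w).left = l
    generalize (split Γ v w).right = r
    have h1 : (inl l * inr r)⁻¹ * h * (inl l * inr r) =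
        (inr r)⁻¹ * ((inl l)⁻¹ * h * inl l) * inr r := by group
    rw [h1]
    generalize (inl l)⁻¹ * h * inl l = k
    rw [← map_inv]
    simp
  intro Y
  obtain ⟨Q, hQ, hf, hd⟩ := PermProd.exists_finite_fixAt h ((fun w => (split Γ v w).left) '' Y)
  have hch : ∀ q ∈ Q, ∃ w ∈ Y, (split Γ v w).left = q := fun q hq => hQ hq
  choose! c hc hc' using hch
  refine ⟨c '' Q, Set.image_subset_iff.2 hc, hf.image c, fun p hp w hw => ?_⟩
  rw [key]
  refine hd _ (fun q hq => ?_) _ ⟨w, hw, rfl⟩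
  rw [← hc' q hq, ← key]
  exact hp _ ⟨q, hq, rfl⟩

theorem finitelyDeterminedConj_parabolic {V : Type*} [Finite V] {Γ : SimpleGraph V}
    (h : ∀ v, FinitelyDetermined (RAAG (Γ.induce {v}ᶜ)) (Cosets Γ v)) (T : Set V) :
    FinitelyDeterminedConj (parabolic Γ T) := by
  suffices H : ∀ S : Set V, S.Finite → FinitelyDeterminedConj (parabolic Γ Sᶜ) by
    rw [← compl_compl T]; exact H _ (Set.toFinite _)
  intro S hS
  induction S, hS using Set.Finite.induction_on with
  | empty =>
    rw [Set.compl_empty, parabolic_univ]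
    exact fun Y => ⟨∅, Set.empty_subset _, Set.finite_empty, fun _ _ _ _ => Subgroup.mem_top _⟩
  | @insert v S _ _ ih =>
    rw [Set.insert_eq, Set.compl_union, parabolic_inter]
    exact (finitelyDeterminedConj_compl_singleton (h v)).inf ih

/-- The properties of right-angled Artin groups on finite graphs established by induction. -/
structure Tame {V : Type*} (Γ : SimpleGraph V) : Prop where
  isMulTorsionFree : IsMulTorsionFree (RAAG Γ)
  conjCommute : ConjCommute (RAAG Γ)
  finitelyDetermined : ∀ T, FinitelyDetermined (RAAG Γ) (RAAG Γ ⧸ parabolic Γ T)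
  pointwiseConjIsConj : PointwiseConjIsConj.{w} (RAAG Γ)

theorem tame_of_isEmpty {V : Type*} [IsEmpty V] (Γ : SimpleGraph V) : Tame.{w} Γ := by
  have : Subsingleton (RAAG Γ) := by
    refine subsingleton_of_forall_eq 1 fun a => ?_
    exact DFunLike.congr_fun (hom_ext (f := MonoidHom.id (RAAG Γ)) (g := 1) isEmptyElim) a
  refine ⟨⟨fun _ _ _ _ _ => Subsingleton.elim _ _⟩, fun x z _ => Subsingleton.elim _ _, fun T Y =>
    ⟨∅, Set.empty_subset _, Set.finite_empty, fun p _ x _ => ?_⟩, .of_subsingleton⟩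
  rw [Subsingleton.elim p 1, one_smul]

theorem tame {V : Type u} [Finite V] (Γ : SimpleGraph V) : Tame.{w} Γ := by
  induction hn : Nat.card V using Nat.strong_induction_on generalizing V with
  | _ n ih =>
    rcases isEmpty_or_nonempty V with hV | ⟨⟨v⟩⟩
    · exact tame_of_isEmpty Γ
    have ih' : ∀ v, Tame.{w} (Γ.induce {v}ᶜ) := fun v => by
      refine ih _ ?_ _ rfl
      rw [← hn]
      exact Set.ncard_lt_card (by simp [Set.ext_iff])
    have := (ih' v).isMulTorsionFree
    have hX : RootStable (RAAG (Γ.induce {v}ᶜ)) (Cosets Γ v) := rootStable _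
    have := PermProd.isMulTorsionFree hX
    have hD : ∀ v, FinitelyDetermined (RAAG (Γ.induce {v}ᶜ)) (Cosets Γ v) := fun v =>
      (ih' v).finitelyDetermined _
    exact ⟨.of_injective _ (split_injective (v := v)),
      (PermProd.conjCommute hX (ih' v).conjCommute).of_injective _ split_injective,
      fun T => (finitelyDeterminedConj_parabolic hD T).finitelyDetermined,
      (PermProd.pointwiseConjIsConj hX (hD v) (ih' v).conjCommute
        (ih' v).pointwiseConjIsConj).of_injective _ split_injective⟩

end RAAG

end

section

open Function

universe u

namespace RAAG

variable {V : Type*} {Γ : SimpleGraph V}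

theorem exists_finite_mem_parabolic (a : RAAG Γ) : ∃ T : Set V, T.Finite ∧ a ∈ parabolic Γ T := by
  let H : Subgroup (RAAG Γ) :=
    { carrier := {a | ∃ T : Set V, T.Finite ∧ a ∈ parabolic Γ T}
      one_mem' := ⟨∅, Set.finite_empty, one_mem _⟩
      mul_mem' := fun {_ _} ⟨S, hS, h⟩ ⟨T, hT, h'⟩ => ⟨S ∪ T, hS.union hT,
        mul_mem (parabolic_mono Set.subset_union_left h)
          (parabolic_mono Set.subset_union_right h')⟩
      inv_mem' := fun {_} ⟨S, hS, h⟩ => ⟨S, hS, inv_mem h⟩ }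
  exact PresentedGroup.generated_by (raagRels Γ) H
    (fun v => ⟨{v}, Set.finite_singleton v, of_mem_parabolic (Set.mem_singleton v)⟩) a

theorem exists_finite_range_le_parabolic {G : Type*} [Group G] [Group.FG G] (f : G →* RAAG Γ) :
    ∃ T : Set V, T.Finite ∧ f.range ≤ parabolic Γ T := by
  obtain ⟨S, hS, hf⟩ := Group.fg_iff.1 (inferInstance : Group.FG G)
  choose T hT hTm using fun a : G => exists_finite_mem_parabolic (f a)
  refine ⟨⋃ s ∈ S, T s, hf.biUnion fun s _ => hT s, ?_⟩
  rw [MonoidHom.range_eq_map, ← hS, MonoidHom.map_closure, Subgroup.closure_le]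
  rintro _ ⟨s, hs, rfl⟩
  exact parabolic_mono (Set.subset_biUnion_of_mem hs) (hTm s)

open Classical in
/-- The retraction onto the group of an induced subgraph. -/
noncomputable def restrict (Γ : SimpleGraph V) (T : Set V) : RAAG Γ →* RAAG (Γ.induce T) :=
  lift (fun v => if h : v ∈ T then of (Γ.induce T) ⟨v, h⟩ else 1) fun u v h => by
    split_ifs with hu hv
    · exact commute_of (Γ := Γ.induce T) (u := ⟨u, hu⟩) (v := ⟨v, hv⟩) h
    all_goals simp

theorem incl_restrict (T : Set V) (a : RAAG Γ) : incl Γ T (restrict Γ T a) = retract Γ T a := by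
  refine DFunLike.congr_fun (hom_ext (f := (incl Γ T).comp (restrict Γ T)) fun v => ?_) a
  rw [MonoidHom.comp_apply]
  by_cases h : v ∈ T
  · rw [retract_of_mem h]; simp [restrict, h]
  · rw [retract_of_notMem h]; simp [restrict, h]

theorem pointwiseConjIsConj_of_injective {G : Type u} [Group G] [Group.FG G] (f : G →* RAAG Γ)
    (hf : Injective f) : PointwiseConjIsConj.{u} G := by
  obtain ⟨T, hT, hfT⟩ := exists_finite_range_le_parabolic f
  have := hT.to_subtype
  refine (tame.{_, u} (Γ.induce T)).pointwiseConjIsConj.of_injective ((restrict Γ T).comp f)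
    fun x y h => hf ?_
  have h1 := congrArg (incl Γ T) h
  simp only [MonoidHom.comp_apply, incl_restrict] at h1
  rwa [mem_parabolic.1 (hfT ⟨x, rfl⟩), mem_parabolic.1 (hfT ⟨y, rfl⟩)] at h1

end RAAG

section HomConj

variable (G F : Type*) [Group G] [Group F]

/-- Homomorphisms up to conjugation in the target. -/
def homConjSetoid : Setoid (G →* F) where
  r p q := ∃ c : F, ∀ g, q g = c * p g * c⁻¹
  iseqv :=
    { refl := fun p => ⟨1, by simp⟩
      symm := fun {p q} ⟨c, hc⟩ => ⟨c⁻¹, fun g => by rw [hc]; group⟩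
      trans := fun {p q r} ⟨c, hc⟩ ⟨d, hd⟩ => ⟨d * c, fun g => by rw [hd, hc]; group⟩ }

/-- Conjugacy classes of homomorphisms. -/
abbrev HomConj : Type _ := Quotient (homConjSetoid G F)

instance : MulAction (MulAut G) (HomConj G F) where
  smul φ := Quotient.map (sa := homConjSetoid G F) (sb := homConjSetoid G F)
    (fun q => q.comp (φ⁻¹ : MulAut G).toMonoidHom)
    fun _ _ ⟨c, hc⟩ => ⟨c, fun g => hc ((φ⁻¹ : MulAut G) g)⟩
  one_smul q := by
    induction q using Quotient.inductionOn
    rfl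
  mul_smul φ ψ q := by
    induction q using Quotient.inductionOn
    rfl

instance [Group.FG G] [Finite F] : Finite (HomConj G F) := by
  have : Finite (G →* F) := by
    obtain ⟨S, hS, hf⟩ := Group.fg_iff.1 (inferInstance : Group.FG G)
    have := hf.to_subtype
    refine Finite.of_injective (fun (q : G →* F) (s : S) => q s) fun p q h => ?_
    exact MonoidHom.eq_of_eqOn_dense hS fun s hs => congrFun h ⟨s, hs⟩
  exact Quotient.finite _

variable {G F}

theorem smul_homConj_mk (φ : MulAut G) (q : G →* F) :
    φ • (Quotient.mk (homConjSetoid G F) q : HomConj G F) =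
      Quotient.mk (homConjSetoid G F) (q.comp (φ⁻¹ : MulAut G).toMonoidHom) := rfl

theorem conj_smul_homConj (g : G) (q : HomConj G F) : MulAut.conj g • q = q := by
  obtain ⟨q, rfl⟩ := Quotient.exists_rep q
  rw [smul_homConj_mk]
  refine Quotient.sound (s := homConjSetoid G F) ⟨q g, fun x => ?_⟩
  change q x = q g * q ((MulAut.conj g)⁻¹ x) * (q g)⁻¹
  rw [MulAut.conj_inv_apply, ← map_mul, ← map_inv, ← map_mul]
  congr 1
  group

/-- The action of outer automorphisms on conjugacy classes of homomorphisms. -/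
def outerAutToPerm (G F : Type*) [Group G] [Group F] :
    OuterAut G →* Equiv.Perm (HomConj G F) :=
  QuotientGroup.lift _ (MulAction.toPermHom (MulAut G) (HomConj G F)) (by
    rintro _ ⟨g, rfl⟩
    ext q
    exact conj_smul_homConj g q)

theorem isConj_of_outerAutToPerm_eq_one {φ : MulAut G} (h : outerAutToPerm G F φ = 1)
    (q : G →* F) (x : G) : IsConj (q x) (q (φ x)) := by
  have h1 : φ • (Quotient.mk (homConjSetoid G F) q : HomConj G F) =
    Quotient.mk (homConjSetoid G F) q :=
    DFunLike.congr_fun h (Quotient.mk (homConjSetoid G F) q)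
  rw [smul_homConj_mk] at h1
  obtain ⟨c, hc⟩ := Quotient.exact h1
  have h2 := hc (φ x)
  rw [isConj_iff]
  exact ⟨c, by rw [h2]; simp⟩

end HomConj

end

/-- If `G` is a finitely generated conjugacy separable group embedding into a
right-angled Artin group, then `Out(G)` is residually finite. -/
theorem out_residuallyFinite_of_conjSep_raag_subgroup
    {V : Type*} (Γ : SimpleGraph V) (G : Type*) [Group G] [Group.FG G]
    (hcs : ConjugacySeparable G)
    (f : G →* RAAG Γ) (hf : Function.Injective f) :
    ResiduallyFinite (OuterAut G) := by
  intro k hk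
  induction k using QuotientGroup.induction_on with
  | H φ =>
  obtain ⟨x, hx⟩ : ∃ x, ¬ IsConj x (φ x) := by
    by_contra! hall
    obtain ⟨h, -, hh⟩ := RAAG.pointwiseConjIsConj_of_injective f hf G (MonoidHom.id G)
      Function.injective_id ⊤ inferInstance φ.toMonoidHom fun x => by
        obtain ⟨c, hc⟩ := isConj_iff.1 (hall x)
        exact ⟨c, Subgroup.mem_top c, hc.symm⟩
    refine hk ((QuotientGroup.eq_one_iff φ).2 ⟨h, ?_⟩)
    ext x
    exact (hh x).symm
  obtain ⟨F, _, _, q, hq⟩ := hcs x (φ x) hx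
  let e := Finite.equivFin (HomConj G F)
  refine ⟨Equiv.Perm (Fin (Nat.card (HomConj G F))), inferInstance, inferInstance,
    e.permCongrHom.toMonoidHom.comp (outerAutToPerm G F), fun h => hq ?_⟩
  refine isConj_of_outerAutToPerm_eq_one (φ := φ) ?_ q x
  exact e.permCongrHom.injective (h.trans (map_one _).symm)
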